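/- arXiv:1707.08329 — 2 statements merged into one kernel-verified Lean document; each statement's English description precedes it below -/
import Mathlib

section
/- Let ξ ∈ ℝ with −1/2 < ξ < 0, let η ∈ ℝ∖{0}, and let μ ∈ ℤ. Then the series Σ_{κ ∈ ℤ} (η/(η²+(κ−μ/2)²))·Γ(1/2+ξ+κ)/Γ(1/2−ξ+κ) converges absolutely, and its sum equals −π²·Im[ 1/( sin(π(1/2+ξ))·sin(π(iη−μ/2))·Γ(1/2−ξ+iη−μ/2)·Γ(1/2−ξ−iη+μ/2) ) ]. -/
open Filter Topology

/-- The ratio `Γ(c)² / (Γ(c + n) Γ(c - n))`, written as a finite product. -/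
noncomputable def gammaRatio (c : ℝ) (n : ℕ) : ℝ :=
  ∏ j ∈ Finset.range n, (c - 1 - j) / (c + j)

lemma gammaRatio_zero (c : ℝ) : gammaRatio c 0 = 1 := by simp [gammaRatio]

lemma gammaRatio_succ (c : ℝ) (n : ℕ) :
    gammaRatio c (n + 1) = gammaRatio c n * ((c - 1 - n) / (c + n)) :=
  Finset.prod_range_succ _ _

lemma abs_gammaRatio_le_one {c : ℝ} (hc : 1 / 2 ≤ c) (n : ℕ) : |gammaRatio c n| ≤ 1 := by
  rw [gammaRatio, Finset.abs_prod]
  refine Finset.prod_le_one (fun _ _ => abs_nonneg _) fun j _ => ?_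
  have hj : (0 : ℝ) ≤ j := j.cast_nonneg
  rw [abs_div, abs_of_pos (show 0 < c + j by linarith), div_le_one (by linarith), abs_le]
  constructor <;> linarith

lemma gammaRatio_eq_mul_gammaRatio_add_one {c : ℝ} (hc : 0 < c) (n : ℕ) :
    gammaRatio c n = (1 - (n : ℝ) ^ 2 / c ^ 2) * gammaRatio (c + 1) n := by
  induction n with
  | zero => simp [gammaRatio_zero]
  | succ n ih =>
    have hn : (0 : ℝ) ≤ n := n.cast_nonneg
    have h1 : c + n ≠ 0 := by positivity
    have h2 : c + 1 + n ≠ 0 := by positivity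
    rw [gammaRatio_succ, gammaRatio_succ, ih]
    push_cast
    field_simp
    ring

lemma tendsto_gammaRatio_add_nat (c : ℝ) (n : ℕ) :
    Tendsto (fun N : ℕ => gammaRatio (c + N) n) atTop (𝓝 1) := by
  have key : ∀ j : ℕ, Tendsto (fun N : ℕ => (c + N - 1 - j) / (c + N + j)) atTop (𝓝 1) := by
    intro j
    have ht : Tendsto (fun N : ℕ => c + (N : ℝ) + j) atTop atTop :=
      tendsto_atTop_add_const_right _ _
        (tendsto_atTop_add_const_left _ _ tendsto_natCast_atTop_atTop)
    have h := (tendsto_const_nhds (x := (1 : ℝ))).sub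
      ((tendsto_const_nhds (x := (1 + 2 * j : ℝ))).div_atTop ht)
    rw [sub_zero] at h
    refine h.congr' ?_
    filter_upwards [ht.eventually_gt_atTop 0] with N hN
    field_simp
    ring
  simpa [gammaRatio] using tendsto_finsetProd (Finset.range n) fun j _ => key j

/-- The alternating sum of `gammaRatio (c + 1)` telescopes. -/
lemma one_add_two_mul_sum_gammaRatio {c : ℝ} (hc : 0 < c) (n : ℕ) :
    1 + 2 * ∑ k ∈ Finset.range n, (-1) ^ (k + 1) * gammaRatio (c + 1) (k + 1) =
      (-1) ^ n * gammaRatio c n * (c / (c + n)) := by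
  have h : ∀ n : ℕ, gammaRatio c n * (c / (c + n)) = (1 - n / c) * gammaRatio (c + 1) n := by
    intro n
    have hn : c + n ≠ 0 := by positivity
    rw [gammaRatio_eq_mul_gammaRatio_add_one hc]
    field_simp
    ring
  rw [mul_assoc, h]
  induction n with
  | zero => simp [gammaRatio_zero]
  | succ n ih =>
    have hn : c + 1 + n ≠ 0 := by positivity
    rw [Finset.sum_range_succ, mul_add, ← add_assoc, ih, gammaRatio_succ]
    push_cast
    field_simp
    ring

lemma mem_integerComplement_of_im_ne_zero {b : ℂ} (hb : b.im ≠ 0) :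
    b ∈ Complex.integerComplement := by
  rintro ⟨n, rfl⟩
  simp at hb

/-- The Mittag-Leffler expansion of the cosecant. -/
lemma hasSum_alternating_cotTerm {b : ℂ} (hb : b.im ≠ 0) :
    HasSum (fun n : ℕ => (-1) ^ (n + 1) * cotTerm b n)
      (Real.pi / Complex.sin (Real.pi * b) - 1 / b) := by
  have hb1 := mem_integerComplement_of_im_ne_zero hb
  have hb2 : b / 2 ∈ Complex.integerComplement :=
    mem_integerComplement_of_im_ne_zero (by simpa using hb)
  have hs1 : HasSum (cotTerm b) _ := (summable_cotTerm hb1).hasSum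
  have hs2 : HasSum (cotTerm (b / 2)) _ := (summable_cotTerm hb2).hasSum
  rw [← cot_series_rep' hb1] at hs1
  rw [← cot_series_rep' hb2] at hs2
  have hodd : HasSum (fun n : ℕ => (1 + (-1) ^ (n + 1)) * cotTerm b n)
      (Real.pi * Complex.cot (Real.pi * (b / 2)) - 1 / (b / 2)) := by
    rw [← zero_add (_ - _)]
    refine HasSum.even_add_odd ?_ ?_
    · simp [pow_succ, pow_mul]
    · convert hs2 using 2 with n
      have e1 : b / 2 - (n + 1) = (b - ((2 * n + 1 : ℕ) + 1)) / 2 := by push_cast; ring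
      have e2 : b / 2 + (n + 1) = (b + ((2 * n + 1 : ℕ) + 1)) / 2 := by push_cast; ring
      rw [cotTerm, cotTerm, e1, e2, one_div_div, one_div_div]
      simp [pow_succ, pow_mul]
      ring
  have hval : Real.pi / Complex.sin (Real.pi * b) - 1 / b =
      Real.pi * Complex.cot (Real.pi * (b / 2)) - 1 / (b / 2) -
        (Real.pi * Complex.cot (Real.pi * b) - 1 / b) := by
    have hsin : Complex.sin (Real.pi * (b / 2)) ≠ 0 := sin_pi_mul_ne_zero hb2
    have hsin' : Complex.sin (Real.pi * b) ≠ 0 := sin_pi_mul_ne_zero hb1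
    have hd : (Real.pi : ℂ) * b = 2 * (Real.pi * (b / 2)) := by ring
    have hb0 : b ≠ 0 := by rintro rfl; simp at hb
    simp only [Complex.cot]
    have hcos : Complex.cos (Real.pi * (b / 2)) ≠ 0 := by
      intro h
      rw [hd, Complex.sin_two_mul, h] at hsin'
      simp at hsin'
    rw [hd, Complex.sin_two_mul, Complex.cos_two_mul]
    generalize Complex.sin (Real.pi * (b / 2)) = s at *
    generalize Complex.cos (Real.pi * (b / 2)) = t at *
    field_simp
    ring
  rw [hval]
  refine (hodd.sub hs1).congr_fun fun n => ?_
  ring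

/-- The symmetrically summed series `∑ (-1)ᵏ Γ(c)² / (Γ(c + k) Γ(c - k) (b + k))` over `k ∈ ℤ`. -/
noncomputable def gammaCardinalSeries (c : ℝ) (b : ℂ) : ℂ :=
  1 / b + ∑' n : ℕ, (-1) ^ (n + 1) * (gammaRatio c (n + 1) : ℂ) * cotTerm b n

lemma norm_gammaRatio_mul_cotTerm_le {c : ℝ} (hc : 1 / 2 ≤ c) (b : ℂ) (n : ℕ) :
    ‖(-1) ^ (n + 1) * (gammaRatio c (n + 1) : ℂ) * cotTerm b n‖ ≤ ‖cotTerm b n‖ := by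
  rw [norm_mul, norm_mul, norm_pow, norm_neg, norm_one, one_pow, one_mul, Complex.norm_real]
  exact mul_le_of_le_one_left (norm_nonneg _) (abs_gammaRatio_le_one hc _)

lemma summable_gammaRatio_mul_cotTerm {c : ℝ} (hc : 1 / 2 ≤ c) {b : ℂ} (hb : b.im ≠ 0) :
    Summable fun n : ℕ => (-1) ^ (n + 1) * (gammaRatio c (n + 1) : ℂ) * cotTerm b n :=
  Summable.of_norm_bounded (summable_cotTerm (mem_integerComplement_of_im_ne_zero hb)).norm
    (norm_gammaRatio_mul_cotTerm_le hc b)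

lemma gammaCardinalSeries_eq_mul_add_one {c : ℝ} (hc : 1 / 2 ≤ c) {b : ℂ} (hb : b.im ≠ 0) :
    gammaCardinalSeries c b = (1 - b ^ 2 / c ^ 2) * gammaCardinalSeries (c + 1) b := by
  have hc0 : 0 < c := by linarith
  have hc' : (c : ℂ) ≠ 0 := by exact_mod_cast hc0.ne'
  have hb0 : b ≠ 0 := by rintro rfl; simp at hb
  have hb1 := mem_integerComplement_of_im_ne_zero hb
  have h1 := (summable_gammaRatio_mul_cotTerm hc hb).hasSum.tendsto_sum_nat.const_add (1 / b)
  have h2 := ((summable_gammaRatio_mul_cotTerm (c := c + 1) (by linarith)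
    hb).hasSum.tendsto_sum_nat.const_add (1 / b)).const_mul (1 - b ^ 2 / (c : ℂ) ^ 2)
  have hq : Tendsto (fun n : ℕ => (-1) ^ n * gammaRatio c n * (c / (c + n))) atTop (𝓝 0) := by
    have ht : Tendsto (fun n : ℕ => c / (c + n)) atTop (𝓝 0) :=
      tendsto_const_nhds.div_atTop
        (tendsto_atTop_add_const_left _ _ tendsto_natCast_atTop_atTop)
    refine squeeze_zero_norm (fun n => ?_) ht
    have hp : 0 ≤ c / (c + n) := by positivity
    rw [norm_mul, norm_mul, norm_pow, norm_neg, norm_one, one_pow, one_mul,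
      Real.norm_of_nonneg hp]
    exact mul_le_of_le_one_left hp (abs_gammaRatio_le_one hc _)
  have hq' : Tendsto (fun n : ℕ => b / (c : ℂ) ^ 2 *
      (((-1) ^ n * gammaRatio c n * (c / (c + n)) : ℝ) : ℂ)) atTop (𝓝 (b / (c : ℂ) ^ 2 * 0)) :=
    ((Complex.continuous_ofReal.tendsto' 0 0 (by simp)).comp hq).const_mul _
  have h3 := h2.add hq'
  rw [mul_zero, add_zero] at h3
  refine tendsto_nhds_unique h1 (h3.congr fun n => ?_)
  rw [← one_add_two_mul_sum_gammaRatio hc0]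
  push_cast
  have hsum : ∑ k ∈ Finset.range n, (-1) ^ (k + 1) * (gammaRatio c (k + 1) : ℂ) * cotTerm b k =
      (1 - b ^ 2 / (c : ℂ) ^ 2) * ∑ k ∈ Finset.range n,
        (-1) ^ (k + 1) * (gammaRatio (c + 1) (k + 1) : ℂ) * cotTerm b k +
      2 * b / (c : ℂ) ^ 2 * ∑ k ∈ Finset.range n,
        (-1) ^ (k + 1) * (gammaRatio (c + 1) (k + 1) : ℂ) := by
    rw [Finset.mul_sum, Finset.mul_sum, ← Finset.sum_add_distrib]
    refine Finset.sum_congr rfl fun k _ => ?_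
    have e1 : b + (k + 1) ≠ 0 := by
      simpa using Complex.integerComplement_add_ne_zero hb1 (k + 1)
    have e2 : b - (k + 1) ≠ 0 := by
      simpa [sub_eq_add_neg] using Complex.integerComplement_add_ne_zero hb1 (-(k + 1))
    rw [gammaRatio_eq_mul_gammaRatio_add_one hc0, cotTerm_identity hb1]
    push_cast
    field_simp
    ring
  rw [hsum]
  field_simp
  ring

lemma gammaCardinalSeries_eq_prod_mul {c : ℝ} (hc : 1 / 2 ≤ c) {b : ℂ} (hb : b.im ≠ 0) (N : ℕ) :
    gammaCardinalSeries c b =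
      (∏ n ∈ Finset.range N, (1 - b ^ 2 / ((c : ℂ) + n) ^ 2)) *
        gammaCardinalSeries (c + N) b := by
  induction N with
  | zero => simp
  | succ N ih =>
    have hN : (0 : ℝ) ≤ N := N.cast_nonneg
    rw [ih, Finset.prod_range_succ,
      gammaCardinalSeries_eq_mul_add_one (c := c + N) (by linarith) hb]
    push_cast
    rw [mul_assoc, add_assoc]

lemma tendsto_gammaCardinalSeries {c : ℝ} (hc : 1 / 2 ≤ c) {b : ℂ} (hb : b.im ≠ 0) :
    Tendsto (fun N : ℕ => gammaCardinalSeries (c + N) b) atTop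
      (𝓝 (Real.pi / Complex.sin (Real.pi * b))) := by
  have h : Tendsto (fun N : ℕ => ∑' n : ℕ,
      (-1) ^ (n + 1) * (gammaRatio (c + N) (n + 1) : ℂ) * cotTerm b n) atTop
      (𝓝 (∑' n : ℕ, (-1) ^ (n + 1) * cotTerm b n)) := by
    refine tendsto_tsum_of_dominated_convergence
      (summable_cotTerm (mem_integerComplement_of_im_ne_zero hb)).norm (fun n => ?_)
      (Eventually.of_forall fun N n => ?_)
    · have h1 := (Complex.continuous_ofReal.tendsto' 1 1 (by simp)).comp
        (tendsto_gammaRatio_add_nat c (n + 1))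
      simpa using (h1.const_mul ((-1 : ℂ) ^ (n + 1))).mul_const (cotTerm b n)
    · have hN : (0 : ℝ) ≤ N := N.cast_nonneg
      exact norm_gammaRatio_mul_cotTerm_le (by linarith) b n
  rw [(hasSum_alternating_cotTerm hb).tsum_eq] at h
  simpa [gammaCardinalSeries] using h.const_add (1 / b)

lemma add_natCast_ne_zero_of_im_ne_zero {s : ℂ} (hs : s.im ≠ 0) (n : ℕ) : s + n ≠ 0 :=
  fun h => hs (by simpa using congrArg Complex.im h)

lemma Gamma_ne_zero_of_im_ne_zero {s : ℂ} (hs : s.im ≠ 0) : Complex.Gamma s ≠ 0 :=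
  Complex.Gamma_ne_zero fun m h => hs (by simpa using congrArg Complex.im h)

/-- The Euler product for `Γ(c)² / (Γ(c - b) Γ(c + b))`. -/
lemma tendsto_prod_one_sub_sq_div_sq {c : ℝ} (hc : 0 < c) {b : ℂ} (hb : b.im ≠ 0) :
    Tendsto (fun N : ℕ => ∏ n ∈ Finset.range N, (1 - b ^ 2 / ((c : ℂ) + n) ^ 2)) atTop
      (𝓝 (Complex.Gamma c ^ 2 / (Complex.Gamma (c - b) * Complex.Gamma (c + b)))) := by
  have hm : ((c : ℂ) - b).im ≠ 0 := by simpa using hb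
  have hp : ((c : ℂ) + b).im ≠ 0 := by simpa using hb
  have h := ((Complex.GammaSeq_tendsto_Gamma c).pow 2).div
    ((Complex.GammaSeq_tendsto_Gamma (c - b)).mul (Complex.GammaSeq_tendsto_Gamma (c + b)))
    (mul_ne_zero (Gamma_ne_zero_of_im_ne_zero hm) (Gamma_ne_zero_of_im_ne_zero hp))
  rw [← tendsto_add_atTop_iff_nat 1]
  refine h.congr' ?_
  filter_upwards [eventually_ne_atTop 0] with N hN
  have hN' : (N : ℂ) ≠ 0 := Nat.cast_ne_zero.mpr hN
  have hprod : ∏ n ∈ Finset.range (N + 1), (1 - b ^ 2 / ((c : ℂ) + n) ^ 2) =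
      (∏ n ∈ Finset.range (N + 1), ((c : ℂ) - b + n)) *
        (∏ n ∈ Finset.range (N + 1), ((c : ℂ) + b + n)) /
        (∏ n ∈ Finset.range (N + 1), ((c : ℂ) + n)) ^ 2 := by
    rw [← Finset.prod_mul_distrib, ← Finset.prod_pow, ← Finset.prod_div_distrib]
    refine Finset.prod_congr rfl fun n _ => ?_
    have : (c : ℂ) + n ≠ 0 := by exact_mod_cast (by positivity : c + n ≠ 0)
    field_simp
    ring
  have h1 : ∏ n ∈ Finset.range (N + 1), ((c : ℂ) - b + n) ≠ 0 :=
    Finset.prod_ne_zero_iff.mpr fun n _ => add_natCast_ne_zero_of_im_ne_zero hm n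
  have h2 : ∏ n ∈ Finset.range (N + 1), ((c : ℂ) + b + n) ≠ 0 :=
    Finset.prod_ne_zero_iff.mpr fun n _ => add_natCast_ne_zero_of_im_ne_zero hp n
  have h3 : ∏ n ∈ Finset.range (N + 1), ((c : ℂ) + n) ≠ 0 :=
    Finset.prod_ne_zero_iff.mpr fun n _ => by exact_mod_cast (by positivity : c + n ≠ 0)
  have hf : (N.factorial : ℂ) ≠ 0 := Nat.cast_ne_zero.mpr N.factorial_ne_zero
  have hpc : (N : ℂ) ^ (c : ℂ) ≠ 0 := by simp [Complex.cpow_eq_zero_iff, hN']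
  have hpb : (N : ℂ) ^ b ≠ 0 := by simp [Complex.cpow_eq_zero_iff, hN']
  simp only [Pi.div_apply, Complex.GammaSeq]
  rw [hprod, Complex.cpow_sub _ _ hN', Complex.cpow_add _ _ hN']
  field_simp

/-- The cardinal series of `z ↦ 1 / (Γ(c + z) Γ(c - z))`. -/
lemma gammaCardinalSeries_eq {c : ℝ} (hc : 1 / 2 ≤ c) {b : ℂ} (hb : b.im ≠ 0) :
    gammaCardinalSeries c b =
      Complex.Gamma c ^ 2 / (Complex.Gamma (c - b) * Complex.Gamma (c + b)) *
        (Real.pi / Complex.sin (Real.pi * b)) :=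
  tendsto_nhds_unique tendsto_const_nhds
    (((tendsto_prod_one_sub_sq_div_sq (by linarith) hb).mul
      (tendsto_gammaCardinalSeries hc hb)).congr fun N =>
        (gammaCardinalSeries_eq_prod_mul hc hb N).symm)

lemma Gamma_div_Gamma_add_natCast {c : ℝ} (h0 : 0 < c) (h1 : c < 1) (n : ℕ) :
    Real.Gamma (1 - c + n) / Real.Gamma (c + n) =
      Real.Gamma (1 - c) / Real.Gamma c * ((-1) ^ n * gammaRatio c n) := by
  induction n with
  | zero => simp [gammaRatio_zero]
  | succ n ih =>
    have hn : (0 : ℝ) ≤ n := n.cast_nonneg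
    have e1 : 1 - c + n ≠ 0 := by linarith
    have e2 : c + n ≠ 0 := by linarith
    push_cast
    rw [← add_assoc, ← add_assoc, Real.Gamma_add_one e1, Real.Gamma_add_one e2,
      mul_div_mul_comm, ih, gammaRatio_succ]
    field_simp
    ring

lemma Gamma_div_Gamma_sub_natCast {c : ℝ} (h0 : 0 < c) (h1 : c < 1) (n : ℕ) :
    Real.Gamma (1 - c - n) / Real.Gamma (c - n) =
      Real.Gamma (1 - c) / Real.Gamma c * ((-1) ^ n * gammaRatio c n) := by
  induction n with
  | zero => simp [gammaRatio_zero]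
  | succ n ih =>
    have hn : (0 : ℝ) ≤ n := n.cast_nonneg
    have e1 : 1 - c - (n + 1) ≠ 0 := by linarith
    have e2 : c - (n + 1) ≠ 0 := by linarith
    have e3 : c + n ≠ 0 := by linarith
    have g1 := Real.Gamma_add_one e1
    have g2 := Real.Gamma_add_one e2
    rw [show 1 - c - ((n : ℝ) + 1) + 1 = 1 - c - n by ring] at g1
    rw [show c - ((n : ℝ) + 1) + 1 = c - n by ring] at g2
    rw [g1, g2, mul_div_mul_comm] at ih
    push_cast
    rw [gammaRatio_succ, pow_succ]
    rw [← mul_right_inj' (div_ne_zero e1 e2), ih]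
    field_simp
    ring

lemma im_one_div_add_intCast (η : ℝ) (μ κ : ℤ) :
    (1 / (Complex.I * (η : ℂ) - (μ : ℂ) / 2 + κ)).im =
      -(η / (η ^ 2 + ((κ : ℝ) - (μ : ℝ) / 2) ^ 2)) := by
  have h : Complex.I * (η : ℂ) - (μ : ℂ) / 2 + κ =
      (((κ : ℝ) - (μ : ℝ) / 2 : ℝ) : ℂ) + (η : ℂ) * Complex.I := by
    push_cast
    ring
  rw [h, one_div, Complex.inv_im, Complex.normSq_add_mul_I, Complex.add_im, Complex.ofReal_im,
    Complex.mul_I_im, Complex.ofReal_re, zero_add, neg_div, add_comm (η ^ 2)]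

lemma summable_div_sq_add_sub_sq {η : ℝ} (hη : η ≠ 0) (x : ℝ) :
    Summable fun κ : ℤ => η / (η ^ 2 + ((κ : ℝ) - x) ^ 2) := by
  have hs : Summable fun κ : ℤ => (2 + 2 * x ^ 2 / η ^ 2) * |η| * (1 / (κ : ℝ) ^ 2) :=
    (Real.summable_one_div_int_pow.mpr one_lt_two).mul_left _
  refine Summable.of_norm_bounded_eventually hs ?_
  filter_upwards [(Set.finite_singleton (0 : ℤ)).compl_mem_cofinite] with κ hκ
  have hκ' : (κ : ℝ) ≠ 0 := by exact_mod_cast hκ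
  have hη2 : 0 < η ^ 2 := by positivity
  have hκ2 : 0 < (κ : ℝ) ^ 2 := by positivity
  have hD : 0 < η ^ 2 + ((κ : ℝ) - x) ^ 2 := by positivity
  rw [norm_div, Real.norm_of_nonneg hD.le, Real.norm_eq_abs, mul_one_div,
    div_le_div_iff₀ hD hκ2, mul_comm (_ + _) |η|, mul_assoc]
  refine mul_le_mul_of_nonneg_left ?_ (abs_nonneg η)
  have e : (2 + 2 * x ^ 2 / η ^ 2) * (η ^ 2 + ((κ : ℝ) - x) ^ 2) =
      2 * η ^ 2 + 2 * x ^ 2 + 2 * ((κ : ℝ) - x) ^ 2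
        + 2 * x ^ 2 / η ^ 2 * ((κ : ℝ) - x) ^ 2 := by
    field_simp
    ring
  have hp : 0 ≤ 2 * x ^ 2 / η ^ 2 * ((κ : ℝ) - x) ^ 2 := by positivity
  rw [e]
  nlinarith [sq_nonneg ((κ : ℝ) - 2 * x)]

lemma hasSum_div_mul_Gamma_div_Gamma {c : ℝ} (h0 : 1 / 2 ≤ c) (h1 : c < 1) {η : ℝ} (hη : η ≠ 0)
    (μ : ℤ) :
    HasSum (fun κ : ℤ => η / (η ^ 2 + ((κ : ℝ) - (μ : ℝ) / 2) ^ 2) *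
        (Real.Gamma (1 - c + κ) / Real.Gamma (c + κ)))
      (-(Real.Gamma (1 - c) / Real.Gamma c *
        (gammaCardinalSeries c (Complex.I * (η : ℂ) - (μ : ℂ) / 2)).im)) := by
  set b : ℂ := Complex.I * (η : ℂ) - (μ : ℂ) / 2 with hbdef
  have hc0 : 0 < c := by linarith
  have hb : b.im ≠ 0 := by simpa [hbdef] using hη
  set w : ℤ → ℝ := fun κ => η / (η ^ 2 + ((κ : ℝ) - (μ : ℝ) / 2) ^ 2) with hw
  set t : ℤ → ℝ := fun κ => Real.Gamma (1 - c + κ) / Real.Gamma (c + κ) with ht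
  set T : ℝ := Real.Gamma (1 - c) / Real.Gamma c with hT
  have hws : Summable w := summable_div_sq_add_sub_sq hη _
  have htn : ∀ n : ℕ, t n = T * ((-1) ^ n * gammaRatio c n) := fun n => by
    simpa [ht] using Gamma_div_Gamma_add_natCast hc0 h1 n
  have htn' : ∀ n : ℕ, t (-n) = T * ((-1) ^ n * gammaRatio c n) := fun n => by
    simpa [ht, ← sub_eq_add_neg] using Gamma_div_Gamma_sub_natCast hc0 h1 n
  have hTn : ∀ n : ℕ, |T * ((-1) ^ n * gammaRatio c n)| ≤ |T| := fun n => by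
    rw [abs_mul, abs_mul, abs_pow, abs_neg, abs_one, one_pow, one_mul]
    exact mul_le_of_le_one_right (abs_nonneg _) (abs_gammaRatio_le_one h0 n)
  have htb : ∀ κ : ℤ, |t κ| ≤ |T| := by
    intro κ
    obtain ⟨n, rfl | rfl⟩ := κ.eq_nat_or_neg
    · rw [htn]
      exact hTn n
    · rw [htn']
      exact hTn n
  have hf : Summable fun κ => w κ * t κ := by
    refine Summable.of_norm_bounded (hws.abs.mul_right |T|) fun κ => ?_
    rw [Real.norm_eq_abs, abs_mul]
    exact mul_le_mul_of_nonneg_left (htb κ) (abs_nonneg _)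
  have hpair : HasSum (fun n : ℕ => w (n + 1 : ℕ) * t (n + 1 : ℕ) +
      w (-(n + 1 : ℕ)) * t (-(n + 1 : ℕ)))
      (-(T * (gammaCardinalSeries c b - 1 / b).im)) := by
    have hS : HasSum (fun n : ℕ => (-1) ^ (n + 1) * (gammaRatio c (n + 1) : ℂ) * cotTerm b n)
        (gammaCardinalSeries c b - 1 / b) := by
      rw [gammaCardinalSeries, add_sub_cancel_left]
      exact (summable_gammaRatio_mul_cotTerm h0 hb).hasSum
    refine ((Complex.hasSum_im hS).mul_left T).neg.congr_fun fun n => ?_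
    have hcot : (cotTerm b n).im = -(w (n + 1 : ℕ) + w (-(n + 1 : ℕ))) := by
      have i1 := im_one_div_add_intCast η μ (n + 1 : ℕ)
      have i2 := im_one_div_add_intCast η μ (-(n + 1 : ℕ))
      have e : cotTerm b n = 1 / (b + ((-(n + 1 : ℕ) : ℤ) : ℂ)) +
          1 / (b + (((n + 1 : ℕ) : ℤ) : ℂ)) := by
        push_cast
        rw [cotTerm, ← sub_eq_add_neg b]
      rw [e, Complex.add_im, hbdef, i1, i2]
      ring
    have e : (-1) ^ (n + 1) * (gammaRatio c (n + 1) : ℂ) * cotTerm b n =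
        (((-1) ^ (n + 1) * gammaRatio c (n + 1) : ℝ) : ℂ) * cotTerm b n := by
      push_cast
      ring
    rw [htn, htn', e, Complex.im_ofReal_mul, hcot]
    ring
  have hz := (hasSum_nat_add_iff' 1).mpr hf.hasSum.nat_add_neg
  have hw0 : w 0 = -(1 / b).im := by
    have h := im_one_div_add_intCast η μ 0
    rw [Int.cast_zero, add_zero] at h
    rw [hbdef, h, neg_neg]
  have ht0 : t 0 = T := by simp [ht, hT]
  have heq := hz.unique hpair
  simp only [Finset.sum_range_one, Nat.cast_zero, neg_zero, Complex.sub_im, hw0, ht0] at heq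
  convert hf.hasSum using 1
  linarith


/-- for `-1/2 < ξ < 0`, `η ∈ ℝ ∖ {0}` and `μ ∈ ℤ`, the bilateral series
`Σ_{κ ∈ ℤ} (η/(η²+(κ-μ/2)²)) Γ(1/2+ξ+κ)/Γ(1/2-ξ+κ)` converges absolutely, with sum
`-π² Im[1/(sin(π(1/2+ξ)) sin(π(iη-μ/2)) Γ(1/2-ξ+iη-μ/2) Γ(1/2-ξ-iη+μ/2))]`
(an application of Dougall's bilateral sum). -/
theorem stmt_14 (ξ : ℝ) (h1 : -(1/2) < ξ) (h2 : ξ < 0) (η : ℝ) (hη : η ≠ 0) (μ : ℤ) :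
    Summable (fun κ : ℤ =>
      ((η / (η ^ 2 + ((κ : ℝ) - (μ : ℝ)/2) ^ 2) : ℝ) : ℂ) *
        (Complex.Gamma (1/2 + (ξ : ℂ) + (κ : ℂ)) / Complex.Gamma (1/2 - (ξ : ℂ) + (κ : ℂ)))) ∧
    (∑' κ : ℤ,
        ((η / (η ^ 2 + ((κ : ℝ) - (μ : ℝ)/2) ^ 2) : ℝ) : ℂ) *
          (Complex.Gamma (1/2 + (ξ : ℂ) + (κ : ℂ)) / Complex.Gamma (1/2 - (ξ : ℂ) + (κ : ℂ))))
      = ((-Real.pi ^ 2 *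
          (1 / (Complex.sin ((Real.pi : ℂ) * (1/2 + (ξ : ℂ))) *
            Complex.sin ((Real.pi : ℂ) * (Complex.I * (η : ℂ) - (μ : ℂ)/2)) *
            Complex.Gamma (1/2 - (ξ : ℂ) + Complex.I * (η : ℂ) - (μ : ℂ)/2) *
            Complex.Gamma (1/2 - (ξ : ℂ) - Complex.I * (η : ℂ) + (μ : ℂ)/2))).im : ℝ) : ℂ) := by
  have hT : Complex.Gamma (1 / 2 + (ξ : ℂ)) * Complex.Gamma (1 / 2 - (ξ : ℂ)) =
      Real.pi / Complex.sin ((Real.pi : ℂ) * (1 / 2 + (ξ : ℂ))) := by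
    rw [← Complex.Gamma_mul_Gamma_one_sub]
    ring_nf
  have hR := hasSum_div_mul_Gamma_div_Gamma (c := 1 / 2 - ξ) (by linarith) (by linarith) hη μ
  have hb : (Complex.I * (η : ℂ) - (μ : ℂ) / 2).im ≠ 0 := by simpa using hη
  have hG : Real.Gamma (1 / 2 - ξ) ≠ 0 := (Real.Gamma_pos_of_pos (by linarith)).ne'
  have hG' : Complex.Gamma (1 / 2 - (ξ : ℂ)) ≠ 0 := by
    have := Complex.ofReal_ne_zero.mpr hG
    rw [← Complex.Gamma_ofReal] at this
    simpa using this
  have hval : -(Real.Gamma (1 - (1 / 2 - ξ)) / Real.Gamma (1 / 2 - ξ) *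
      (gammaCardinalSeries (1 / 2 - ξ) (Complex.I * (η : ℂ) - (μ : ℂ) / 2)).im) =
      -Real.pi ^ 2 *
          (1 / (Complex.sin ((Real.pi : ℂ) * (1/2 + (ξ : ℂ))) *
            Complex.sin ((Real.pi : ℂ) * (Complex.I * (η : ℂ) - (μ : ℂ)/2)) *
            Complex.Gamma (1/2 - (ξ : ℂ) + Complex.I * (η : ℂ) - (μ : ℂ)/2) *
            Complex.Gamma (1/2 - (ξ : ℂ) - Complex.I * (η : ℂ) + (μ : ℂ)/2))).im := by
    rw [← Complex.im_ofReal_mul, neg_mul, ← Complex.im_ofReal_mul,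
      gammaCardinalSeries_eq (by linarith) hb, Complex.ofReal_div, ← Complex.Gamma_ofReal,
      ← Complex.Gamma_ofReal]
    congr 2
    push_cast
    rw [show (1 : ℂ) - (1 / 2 - ξ) = 1 / 2 + ξ by ring,
      show (1 / 2 : ℂ) - ξ - (Complex.I * η - μ / 2) = 1 / 2 - ξ - Complex.I * η + μ / 2 by ring,
      show (1 / 2 : ℂ) - ξ + (Complex.I * η - μ / 2) = 1 / 2 - ξ + Complex.I * η - μ / 2 by ring]
    calc _ = Complex.Gamma (1 / 2 + (ξ : ℂ)) * Complex.Gamma (1 / 2 - (ξ : ℂ)) * Real.pi /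
          (Complex.sin ((Real.pi : ℂ) * (Complex.I * (η : ℂ) - (μ : ℂ) / 2)) *
            Complex.Gamma (1 / 2 - (ξ : ℂ) + Complex.I * (η : ℂ) - (μ : ℂ) / 2) *
            Complex.Gamma (1 / 2 - (ξ : ℂ) - Complex.I * (η : ℂ) + (μ : ℂ) / 2)) := by
          field_simp
      _ = _ := by
          rw [hT]
          ring
  have hC := (Complex.hasSum_ofReal.mpr hR)
  rw [hval] at hC
  have hfun : (fun κ : ℤ =>
      ((η / (η ^ 2 + ((κ : ℝ) - (μ : ℝ)/2) ^ 2) : ℝ) : ℂ) *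
        (Complex.Gamma (1/2 + (ξ : ℂ) + (κ : ℂ)) / Complex.Gamma (1/2 - (ξ : ℂ) + (κ : ℂ)))) =
      fun κ : ℤ => ((η / (η ^ 2 + ((κ : ℝ) - (μ : ℝ) / 2) ^ 2) *
        (Real.Gamma (1 - (1 / 2 - ξ) + κ) / Real.Gamma (1 / 2 - ξ + κ)) : ℝ) : ℂ) := by
    funext κ
    rw [Complex.ofReal_mul, Complex.ofReal_div (Real.Gamma _), ← Complex.Gamma_ofReal,
      ← Complex.Gamma_ofReal]
    push_cast
    ring_nf
  rw [hfun]
  exact ⟨hC.summable, hC.tsum_eq⟩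
end

section
/- Let ζ = ξ + iη with ξ, η ∈ ℝ, −1/2 < ξ < 0, and let μ be an even integer. Set c(ξ) = π^{1/2}·2^{−2ξ}·Γ(−ξ)/Γ(1/2+ξ). Then the double integral below converges absolutely and (1/c(ξ))·∬_{ℝ×ℝ} f_{ζ,μ}(t)·f_{conj(ζ),−μ}(u)·|t−u|^{−2ξ−1} dt du = 2^{2ξ}·Re[ (Γ(1/2+conj(ζ)+μ/2)/Γ(1/2−ζ+μ/2))·(1 + i·tan(πξ)·tanh(πη)) ]. -/
open MeasureTheory

/-- `f_{ζ,μ}(t) = π^{-1/2}(1+it)^{ζ-1/2+μ/2}(1-it)^{ζ-1/2-μ/2}` (principal branch powers). -/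
noncomputable def fz (ζ : ℂ) (μ : ℤ) (t : ℝ) : ℂ :=
  (Real.pi : ℂ) ^ (-(1/2) : ℂ) * ((1 : ℂ) + (t : ℂ) * Complex.I) ^ (ζ - 1/2 + (μ : ℂ)/2) *
    ((1 : ℂ) - (t : ℂ) * Complex.I) ^ (ζ - 1/2 - (μ : ℂ)/2)

/-- Exponential parameter integrals are complex differentiable. -/
lemma differentiableAt_integral_mul_exp {α : Type*} [MeasurableSpace α] {μ : Measure α}
    {g X : α → ℂ} (hg : AEStronglyMeasurable g μ) (hX : AEStronglyMeasurable X μ)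
    {z₀ : ℂ} {δ : ℝ} (hδ : 0 < δ)
    (h : Integrable (fun t => ‖g t‖ * Real.exp ((z₀ * X t).re + δ * ‖X t‖)) μ) :
    DifferentiableAt ℂ (fun z => ∫ t, g t * Complex.exp (z * X t) ∂μ) z₀ := by
  have key := hasDerivAt_integral_of_dominated_loc_of_deriv_le
    (F := fun z t => g t * Complex.exp (z * X t))
    (F' := fun z t => g t * (Complex.exp (z * X t) * X t)) (μ := μ) (x₀ := z₀)
    (s := Metric.ball z₀ (δ / 2))
    (bound := fun t => (2 / δ) * (‖g t‖ * Real.exp ((z₀ * X t).re + δ * ‖X t‖)))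
    (Metric.ball_mem_nhds _ (by positivity)) ?_ ?_ ?_ ?_ (h.const_mul _) ?_
  · exact key.2.differentiableAt
  · exact Filter.Eventually.of_forall fun z =>
      hg.mul (Complex.continuous_exp.comp_aestronglyMeasurable (hX.const_mul z))
  · refine h.mono
      (hg.mul (Complex.continuous_exp.comp_aestronglyMeasurable (hX.const_mul z₀))) ?_
    refine Filter.Eventually.of_forall fun t => ?_
    rw [norm_mul, Complex.norm_exp, norm_mul, norm_norm, Real.norm_of_nonneg (Real.exp_nonneg _)]
    gcongr
    have : 0 ≤ δ * ‖X t‖ := by positivity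
    linarith
  · exact hg.mul ((Complex.continuous_exp.comp_aestronglyMeasurable (hX.const_mul z₀)).mul hX)
  · refine Filter.Eventually.of_forall fun t z hz => ?_
    rw [norm_mul, norm_mul, Complex.norm_exp]
    have h1 : (z * X t).re ≤ (z₀ * X t).re + δ / 2 * ‖X t‖ := by
      have : z * X t = z₀ * X t + (z - z₀) * X t := by ring
      rw [this, Complex.add_re]
      have h2 := Complex.re_le_norm ((z - z₀) * X t)
      rw [norm_mul] at h2
      have h3 : ‖z - z₀‖ ≤ δ / 2 := by
        rw [Metric.mem_ball, dist_eq_norm] at hz; exact hz.le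
      have := mul_le_mul_of_nonneg_right h3 (norm_nonneg (X t))
      linarith
    have h4 : ‖X t‖ ≤ 2 / δ * Real.exp (δ / 2 * ‖X t‖) := by
      have := Real.add_one_le_exp (δ / 2 * ‖X t‖)
      calc ‖X t‖ = 2 / δ * (δ / 2 * ‖X t‖) := by field_simp
        _ ≤ _ := by gcongr; linarith
    calc ‖g t‖ * (Real.exp (z * X t).re * ‖X t‖)
        ≤ ‖g t‖ * (Real.exp ((z₀ * X t).re + δ / 2 * ‖X t‖) *
            (2 / δ * Real.exp (δ / 2 * ‖X t‖))) := by gcongr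
      _ = 2 / δ * (‖g t‖ * (Real.exp ((z₀ * X t).re + δ / 2 * ‖X t‖) *
            Real.exp (δ / 2 * ‖X t‖))) := by ring
      _ = _ := by rw [← Real.exp_add]; ring_nf
  · refine Filter.Eventually.of_forall fun t z hz => ?_
    exact (((hasDerivAt_mul_const (X t)).cexp).const_mul (g t))

lemma integrableOn_cpow_mul_exp_neg_mul {a : ℂ} (ha : 0 < a.re) {r : ℝ} (hr : 0 < r) :
    IntegrableOn (fun t : ℝ => ‖(t : ℂ) ^ (a - 1)‖ * Real.exp (-(r * t))) (Set.Ioi 0) := by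
  have h := integrableOn_rpow_mul_exp_neg_mul_rpow (p := 1) (s := a.re - 1) (b := r)
    (by linarith) one_pos hr
  refine h.congr_fun (fun t ht => ?_) measurableSet_Ioi
  simp only [Real.rpow_one]
  rw [Complex.norm_cpow_eq_rpow_re_of_pos ht]
  simp

lemma aestronglyMeasurable_ofReal_cpow (s : ℂ) (μ : Measure ℝ) :
    AEStronglyMeasurable (fun t : ℝ => (t : ℂ) ^ s) μ :=
  (Measurable.pow_const (by fun_prop) s).aestronglyMeasurable

/-- The Laplace transform of `t ^ (a - 1)` at a complex point of the right half-plane. -/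
lemma integral_cpow_mul_exp_neg_mul_complex {a r : ℂ} (ha : 0 < a.re) (hr : 0 < r.re) :
    ∫ t : ℝ in Set.Ioi 0, (t : ℂ) ^ (a - 1) * Complex.exp (-(r * t)) =
      r ^ (-a) * Complex.Gamma a := by
  have hopen : IsOpen {z : ℂ | 0 < z.re} := isOpen_lt continuous_const Complex.continuous_re
  have hd1 : DifferentiableOn ℂ (fun z : ℂ => ∫ t : ℝ in Set.Ioi 0,
      (t : ℂ) ^ (a - 1) * Complex.exp (z * (-(t : ℂ)))) {z : ℂ | 0 < z.re} := by
    intro z hz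
    simp only [Set.mem_ofPred_eq] at hz
    refine (differentiableAt_integral_mul_exp (δ := z.re / 2)
      (aestronglyMeasurable_ofReal_cpow _ _) (by fun_prop) (by positivity)
      ?_).differentiableWithinAt
    refine IntegrableOn.congr_fun
      (integrableOn_cpow_mul_exp_neg_mul ha (r := z.re / 2) (by positivity))
      (fun t ht => ?_) measurableSet_Ioi
    simp only [norm_neg, Complex.norm_real, Real.norm_of_nonneg (le_of_lt ht)]
    congr 2
    simp
    ring
  have hd2 : DifferentiableOn ℂ (fun z : ℂ => z ^ (-a) * Complex.Gamma a) {z : ℂ | 0 < z.re} := by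
    intro z hz
    refine DifferentiableAt.differentiableWithinAt ?_
    refine DifferentiableAt.mul_const ?_ _
    exact (differentiableAt_id).cpow_const (Or.inl hz)
  have hfr : ∃ᶠ z : ℂ in nhdsWithin (1 : ℂ) {1}ᶜ, (∫ t : ℝ in Set.Ioi 0,
      (t : ℂ) ^ (a - 1) * Complex.exp (z * (-(t : ℂ)))) = z ^ (-a) * Complex.Gamma a := by
    have ht : Filter.Tendsto (fun x : ℝ => (x : ℂ)) (nhdsWithin 1 (Set.Ioi 1))
        (nhdsWithin (1 : ℂ) {1}ᶜ) := by
      refine tendsto_nhdsWithin_iff.2 ⟨?_, ?_⟩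
      · exact (Complex.continuous_ofReal.tendsto' 1 1 (by simp)).mono_left nhdsWithin_le_nhds
      · filter_upwards [self_mem_nhdsWithin] with x hx
        simp only [Set.mem_compl_iff, Set.mem_singleton_iff]
        exact_mod_cast (ne_of_gt hx)
    refine ht.frequently (Filter.Eventually.frequently ?_)
    filter_upwards [self_mem_nhdsWithin] with x hx
    have hx0 : (0 : ℝ) < x := lt_trans one_pos hx
    have := Complex.integral_cpow_mul_exp_neg_mul_Ioi ha hx0
    simp only [mul_neg]
    rw [this, one_div, Complex.inv_cpow, Complex.cpow_neg]
    rw [Complex.arg_ofReal_of_nonneg hx0.le]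
    exact Real.pi_pos.ne
  have := AnalyticOnNhd.eqOn_of_preconnected_of_frequently_eq (hd1.analyticOnNhd hopen)
    (hd2.analyticOnNhd hopen) (convex_halfSpace_re_gt 0).isPreconnected
    (by simp : (1 : ℂ) ∈ {z : ℂ | 0 < z.re}) hfr hr
  simpa [mul_neg] using this

lemma one_add_ofReal_mul_I_ne_zero (x : ℝ) : (1 : ℂ) + (x : ℂ) * Complex.I ≠ 0 := by
  intro h
  simpa using congrArg Complex.re h

lemma one_sub_ofReal_mul_I_ne_zero (x : ℝ) : (1 : ℂ) - (x : ℂ) * Complex.I ≠ 0 := by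
  intro h
  simpa using congrArg Complex.re h

lemma conj_one_add_ofReal_mul_I (x : ℝ) :
    (starRingEnd ℂ) ((1 : ℂ) + (x : ℂ) * Complex.I) = 1 - (x : ℂ) * Complex.I := by
  simp [sub_eq_add_neg]

lemma log_one_sub_ofReal_mul_I (x : ℝ) :
    Complex.log ((1 : ℂ) - (x : ℂ) * Complex.I) =
      (starRingEnd ℂ) (Complex.log ((1 : ℂ) + (x : ℂ) * Complex.I)) := by
  rw [← conj_one_add_ofReal_mul_I, Complex.log_conj]
  exact Complex.slitPlane_arg_ne_pi (Or.inl (by simp))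

lemma norm_one_add_ofReal_mul_I (x : ℝ) :
    ‖(1 : ℂ) + (x : ℂ) * Complex.I‖ = (1 + x ^ 2) ^ (1 / 2 : ℝ) := by
  rw [← Real.sqrt_eq_rpow, Complex.norm_eq_sqrt_sq_add_sq]
  simp

lemma norm_one_add_ofReal_mul_I_cpow_le (x : ℝ) (s : ℂ) :
    ‖((1 : ℂ) + (x : ℂ) * Complex.I) ^ s‖ ≤
      Real.exp (Real.pi * |s.im|) * (1 + x ^ 2) ^ (s.re / 2) := by
  rw [Complex.norm_cpow_of_ne_zero (one_add_ofReal_mul_I_ne_zero x), norm_one_add_ofReal_mul_I,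
    ← Real.rpow_mul (by positivity), div_eq_mul_inv, ← Real.exp_neg, mul_comm]
  have h : -(Complex.arg ((1 : ℂ) + (x : ℂ) * Complex.I) * s.im) ≤ Real.pi * |s.im| := by
    calc _ ≤ |Complex.arg ((1 : ℂ) + (x : ℂ) * Complex.I) * s.im| := neg_le_abs _
      _ ≤ _ := by rw [abs_mul]; gcongr; exact Complex.abs_arg_le_pi _
  rw [show 1 / 2 * s.re = s.re / 2 by ring]
  gcongr

lemma continuous_one_add_ofReal_mul_I_cpow (s : ℂ) :
    Continuous fun x : ℝ => ((1 : ℂ) + (x : ℂ) * Complex.I) ^ s := by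
  refine Continuous.cpow (by fun_prop) continuous_const fun x => Or.inl (by simp)

lemma continuous_one_sub_ofReal_mul_I_cpow (s : ℂ) :
    Continuous fun x : ℝ => ((1 : ℂ) - (x : ℂ) * Complex.I) ^ s := by
  refine Continuous.cpow (by fun_prop) continuous_const fun x => Or.inl (by simp)

lemma integrable_one_add_sq_rpow {r : ℝ} (hr : r < -1) :
    Integrable fun x : ℝ => (1 + x ^ 2) ^ (r / 2) := by
  have := integrable_rpow_neg_one_add_norm_sq (E := ℝ) (μ := volume) (r := -r)
    (by simp; linarith)
  simpa using this

lemma integrable_one_add_ofReal_mul_I_cpow {s : ℂ} (hs : s.re < -1) :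
    Integrable fun x : ℝ => ((1 : ℂ) + (x : ℂ) * Complex.I) ^ s :=
  ((integrable_one_add_sq_rpow hs).const_mul _).mono'
    (continuous_one_add_ofReal_mul_I_cpow s).aestronglyMeasurable
    (Filter.Eventually.of_forall fun x => norm_one_add_ofReal_mul_I_cpow_le x s)

lemma integrable_one_sub_ofReal_mul_I_cpow {s : ℂ} (hs : s.re < -1) :
    Integrable fun x : ℝ => ((1 : ℂ) - (x : ℂ) * Complex.I) ^ s := by
  simpa [sub_eq_add_neg] using (integrable_one_add_ofReal_mul_I_cpow hs).comp_neg

/-- The integrand `t ^ (a - 1) * exp (-t)` of the Gamma function, extended by zero. -/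
noncomputable def gammaKernel (a : ℂ) : ℝ → ℂ :=
  (Set.Ioi 0).indicator fun t : ℝ => (t : ℂ) ^ (a - 1) * Complex.exp (-(t : ℂ))

lemma integrable_gammaKernel {a : ℂ} (ha : 0 < a.re) : Integrable (gammaKernel a) := by
  rw [gammaKernel, integrable_indicator_iff measurableSet_Ioi]
  refine (Complex.GammaIntegral_convergent ha).congr_fun (fun t _ => ?_) measurableSet_Ioi
  simp only
  rw [mul_comm]; push_cast; rfl

lemma fourier_gammaKernel {a : ℂ} (ha : 0 < a.re) (w : ℝ) :
    FourierTransform.fourier (gammaKernel a) w =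
      ((1 : ℂ) + ((2 * Real.pi * w : ℝ) : ℂ) * Complex.I) ^ (-a) * Complex.Gamma a := by
  rw [← integral_cpow_mul_exp_neg_mul_complex ha (by simp), Real.fourier_eq',
    ← integral_indicator measurableSet_Ioi]
  congr 1
  ext t
  by_cases ht : t ∈ Set.Ioi (0 : ℝ)
  · simp only [gammaKernel, Set.indicator_of_mem ht, smul_eq_mul]
    rw [mul_left_comm, ← Complex.exp_add]
    congr 2
    simp
    ring
  · simp [gammaKernel, Set.indicator_of_notMem ht]

lemma continuousAt_gammaKernel (a : ℂ) {t : ℝ} (ht : 0 < t) :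
    ContinuousAt (gammaKernel a) t := by
  have h : ContinuousAt (fun t : ℝ => (t : ℂ) ^ (a - 1) * Complex.exp (-(t : ℂ))) t := by
    refine ContinuousAt.mul ?_ (by fun_prop)
    exact ContinuousAt.cpow (by fun_prop) continuousAt_const (Or.inl (by simpa using ht))
  refine h.congr ?_
  filter_upwards [Ioi_mem_nhds ht] with y hy
  simp [gammaKernel, Set.indicator_of_mem hy]

lemma integral_exp_mul_one_add_cpow {a : ℂ} (ha : 1 < a.re) {t : ℝ} (ht : 0 < t) :
    ∫ w : ℝ, Complex.exp (((2 * Real.pi * w : ℝ) : ℂ) * Complex.I * t) *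
      ((1 : ℂ) + ((2 * Real.pi * w : ℝ) : ℂ) * Complex.I) ^ (-a) =
      (t : ℂ) ^ (a - 1) * Complex.exp (-(t : ℂ)) / Complex.Gamma a := by
  have ha0 : 0 < a.re := by linarith
  have hG : Complex.Gamma a ≠ 0 := Complex.Gamma_ne_zero_of_re_pos ha0
  have hInt : Integrable (FourierTransform.fourier (gammaKernel a)) := by
    have h := ((integrable_one_add_ofReal_mul_I_cpow (s := -a) (by simpa using ha)).comp_mul_left'
      (R := 2 * Real.pi) (by positivity)).mul_const (Complex.Gamma a)
    refine h.congr (Filter.Eventually.of_forall fun w => ?_)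
    simp only [fourier_gammaKernel ha0]
  have := (integrable_gammaKernel ha0).fourierInv_fourier_eq hInt (continuousAt_gammaKernel a ht)
  rw [Real.fourierInv_eq'] at this
  simp only [fourier_gammaKernel ha0, smul_eq_mul, ← mul_assoc] at this
  rw [integral_mul_const] at this
  rw [eq_div_iff hG]
  rw [gammaKernel, Set.indicator_of_mem (Set.mem_Ioi.2 ht)] at this
  rw [← this]
  congr 2
  ext w
  congr 2
  simp
  ring

lemma integral_one_add_cpow_mul_one_sub_cpow_of_one_lt_re {a b : ℂ} (ha : 1 < a.re)
    (hb : 0 < b.re) :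
    ∫ w : ℝ, ((1 : ℂ) + ((2 * Real.pi * w : ℝ) : ℂ) * Complex.I) ^ (-a) *
      ((1 : ℂ) - ((2 * Real.pi * w : ℝ) : ℂ) * Complex.I) ^ (-b) =
    2 ^ (1 - (a + b)) * Complex.Gamma (a + b - 1) * (Complex.Gamma a)⁻¹ *
      (Complex.Gamma b)⁻¹ := by
  have ha0 : 0 < a.re := by linarith
  have hGb : Complex.Gamma b ≠ 0 := Complex.Gamma_ne_zero_of_re_pos hb
  rw [← div_eq_mul_inv _ (Complex.Gamma b), eq_div_iff hGb, ← integral_mul_const]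
  have step : ∀ w : ℝ, ((1 : ℂ) + ((2 * Real.pi * w : ℝ) : ℂ) * Complex.I) ^ (-a) *
      ((1 : ℂ) - ((2 * Real.pi * w : ℝ) : ℂ) * Complex.I) ^ (-b) * Complex.Gamma b =
      ∫ t : ℝ in Set.Ioi 0, ((1 : ℂ) + ((2 * Real.pi * w : ℝ) : ℂ) * Complex.I) ^ (-a) *
        ((t : ℂ) ^ (b - 1) *
          Complex.exp (-(((1 : ℂ) - ((2 * Real.pi * w : ℝ) : ℂ) * Complex.I) * t))) := by
    intro w
    rw [integral_const_mul, integral_cpow_mul_exp_neg_mul_complex hb (by simp)]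
    ring
  simp_rw [step]
  rw [integral_integral_swap]
  · have inner : ∀ t ∈ Set.Ioi (0 : ℝ),
        (∫ w : ℝ, ((1 : ℂ) + ((2 * Real.pi * w : ℝ) : ℂ) * Complex.I) ^ (-a) *
        ((t : ℂ) ^ (b - 1) *
          Complex.exp (-(((1 : ℂ) - ((2 * Real.pi * w : ℝ) : ℂ) * Complex.I) * t)))) =
        (t : ℂ) ^ (a + b - 1 - 1) * Complex.exp (-(((2 : ℝ) : ℂ) * t)) *
          (Complex.Gamma a)⁻¹ := by
      intro t ht
      have ht0 : (t : ℂ) ≠ 0 := by exact_mod_cast (ne_of_gt ht)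
      have e1 : (t : ℂ) ^ (a + b - 1 - 1) = (t : ℂ) ^ (a - 1) * (t : ℂ) ^ (b - 1) := by
        rw [← Complex.cpow_add _ _ ht0]; ring_nf
      have e2 : Complex.exp (-(((2 : ℝ) : ℂ) * t)) =
          Complex.exp (-(t : ℂ)) * Complex.exp (-(t : ℂ)) := by
        rw [← Complex.exp_add]; push_cast; ring_nf
      have e3 := integral_exp_mul_one_add_cpow ha ht
      calc _ = ∫ w : ℝ, ((t : ℂ) ^ (b - 1) * Complex.exp (-(t : ℂ))) *
              (Complex.exp (((2 * Real.pi * w : ℝ) : ℂ) * Complex.I * t) *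
              ((1 : ℂ) + ((2 * Real.pi * w : ℝ) : ℂ) * Complex.I) ^ (-a)) := by
            congr 1
            ext w
            have : Complex.exp (-(((1 : ℂ) - ((2 * Real.pi * w : ℝ) : ℂ) * Complex.I) * t)) =
                Complex.exp (-(t : ℂ)) *
                  Complex.exp (((2 * Real.pi * w : ℝ) : ℂ) * Complex.I * t) := by
              rw [← Complex.exp_add]; ring_nf
            rw [this]; ring
        _ = _ := by
            rw [integral_const_mul, e3, e1, e2]; ring
    rw [setIntegral_congr_fun measurableSet_Ioi inner, integral_mul_const,
      Complex.integral_cpow_mul_exp_neg_mul_Ioi (by simp; linarith) two_pos]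
    have : ((1 : ℂ) / ((2 : ℝ) : ℂ)) ^ (a + b - 1) = 2 ^ (1 - (a + b)) := by
      rw [one_div, Complex.inv_cpow _ _ (by
        rw [Complex.arg_ofReal_of_nonneg zero_le_two]; exact Real.pi_pos.ne),
        ← Complex.cpow_neg]
      push_cast; ring_nf
    rw [this]
  · have hA : Integrable (fun w : ℝ =>
        ((1 : ℂ) + ((2 * Real.pi * w : ℝ) : ℂ) * Complex.I) ^ (-a)) :=
      (integrable_one_add_ofReal_mul_I_cpow (s := -a) (by simpa using ha)).comp_mul_left'
        (R := 2 * Real.pi) (by positivity)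
    have hB : Integrable (fun t : ℝ => (t : ℂ) ^ (b - 1) * Complex.exp (-(t : ℂ)))
        (volume.restrict (Set.Ioi 0)) := by
      refine (Complex.GammaIntegral_convergent hb).congr_fun (fun t _ => ?_) measurableSet_Ioi
      simp only
      rw [mul_comm]; push_cast; rfl
    refine (hA.mul_prod hB).mono ?_ (Filter.Eventually.of_forall fun p => ?_)
    · refine Measurable.aestronglyMeasurable ?_
      simp only [Function.uncurry_def]
      fun_prop
    · simp only [Function.uncurry_def, norm_mul, Complex.norm_exp]
      refine le_of_eq ?_
      simp

/-- Cauchy's beta integral. -/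
lemma integral_one_add_cpow_mul_one_sub_cpow {c : ℂ} (hc : 1 < c.re) (a : ℂ) :
    ∫ x : ℝ, ((1 : ℂ) + (x : ℂ) * Complex.I) ^ (-a) *
      ((1 : ℂ) - (x : ℂ) * Complex.I) ^ (-(c - a)) =
    2 * Real.pi * 2 ^ (1 - c) * Complex.Gamma (c - 1) * (Complex.Gamma a)⁻¹ *
      (Complex.Gamma (c - a))⁻¹ := by
  set X : ℝ → ℂ := fun x => Complex.log ((1 : ℂ) - (x : ℂ) * Complex.I) -
    Complex.log ((1 : ℂ) + (x : ℂ) * Complex.I) with hX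
  have hXarg : ∀ x, X x = ((-2 * Complex.arg ((1 : ℂ) + (x : ℂ) * Complex.I) : ℝ) : ℂ) *
      Complex.I := by
    intro x
    apply Complex.ext <;> simp [hX, log_one_sub_ofReal_mul_I, Complex.log_im]
    ring
  have hXn : ∀ x, ‖X x‖ ≤ 2 * Real.pi := by
    intro x
    rw [hXarg, norm_mul, Complex.norm_I, mul_one, Complex.norm_real, norm_mul]
    simp only [norm_neg, Real.norm_eq_abs, abs_two]
    gcongr
    exact Complex.abs_arg_le_pi _
  have hXm : Measurable X := by
    rw [hX]; fun_prop
  have hrew : ∀ (a : ℂ) (x : ℝ), ((1 : ℂ) + (x : ℂ) * Complex.I) ^ (-a) *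
      ((1 : ℂ) - (x : ℂ) * Complex.I) ^ (-(c - a)) =
      ((1 : ℂ) - (x : ℂ) * Complex.I) ^ (-c) * Complex.exp (a * X x) := by
    intro a x
    rw [Complex.cpow_def_of_ne_zero (one_add_ofReal_mul_I_ne_zero x),
      Complex.cpow_def_of_ne_zero (one_sub_ofReal_mul_I_ne_zero x),
      Complex.cpow_def_of_ne_zero (one_sub_ofReal_mul_I_ne_zero x),
      ← Complex.exp_add, ← Complex.exp_add, hX]
    ring_nf
  have hd1 : Differentiable ℂ fun a : ℂ => ∫ x : ℝ, ((1 : ℂ) + (x : ℂ) * Complex.I) ^ (-a) *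
      ((1 : ℂ) - (x : ℂ) * Complex.I) ^ (-(c - a)) := by
    intro z
    simp_rw [hrew]
    refine differentiableAt_integral_mul_exp (δ := 1)
      (continuous_one_sub_ofReal_mul_I_cpow _).aestronglyMeasurable
      hXm.aestronglyMeasurable one_pos ?_
    refine ((integrable_one_sub_ofReal_mul_I_cpow (s := -c)
      (by simpa using hc)).norm.mul_const
        (Real.exp (‖z‖ * (2 * Real.pi) + 1 * (2 * Real.pi)))).mono' ?_ ?_
    · refine (continuous_one_sub_ofReal_mul_I_cpow _).norm.aestronglyMeasurable.mul ?_
      refine Measurable.aestronglyMeasurable ?_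
      fun_prop
    · refine Filter.Eventually.of_forall fun x => ?_
      rw [norm_mul, norm_norm, Real.norm_of_nonneg (Real.exp_nonneg _)]
      gcongr
      · refine (Complex.re_le_norm _).trans ?_
        rw [norm_mul]
        gcongr
        exact hXn x
      · exact hXn x
  have hd2 : Differentiable ℂ fun a : ℂ => 2 * Real.pi * 2 ^ (1 - c) * Complex.Gamma (c - 1) *
      (Complex.Gamma a)⁻¹ * (Complex.Gamma (c - a))⁻¹ := by
    refine Differentiable.mul (Differentiable.mul (by fun_prop)
      Complex.differentiable_one_div_Gamma) ?_
    exact Complex.differentiable_one_div_Gamma.comp (by fun_prop)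
  refine congrFun (AnalyticOnNhd.eq_of_eventuallyEq
    (hd1.differentiableOn.analyticOnNhd isOpen_univ)
    (hd2.differentiableOn.analyticOnNhd isOpen_univ)
    (z₀ := (((1 + c.re) / 2 : ℝ) : ℂ)) ?_) a
  have hopen : IsOpen {z : ℂ | 1 < z.re ∧ z.re < c.re} :=
    (isOpen_lt continuous_const Complex.continuous_re).inter
      (isOpen_lt Complex.continuous_re continuous_const)
  filter_upwards [hopen.mem_nhds (x := (((1 + c.re) / 2 : ℝ) : ℂ))
    ⟨by simp only [Complex.ofReal_re]; linarith, by simp only [Complex.ofReal_re]; linarith⟩]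
    with z hz
  have h := integral_one_add_cpow_mul_one_sub_cpow_of_one_lt_re (a := z) (b := c - z) hz.1
    (by simpa using hz.2)
  rw [add_sub_cancel] at h
  have hs := Measure.integral_comp_mul_left (fun x : ℝ => ((1 : ℂ) + (x : ℂ) * Complex.I) ^ (-z) *
      ((1 : ℂ) - (x : ℂ) * Complex.I) ^ (-(c - z))) (2 * Real.pi)
  rw [h, abs_of_pos (by positivity)] at hs
  have hpi : (2 * Real.pi : ℂ) ≠ 0 := by
    simp [Real.pi_ne_zero]
  rw [Complex.real_smul, eq_comm] at hs
  push_cast at hs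
  rw [inv_mul_eq_iff_eq_mul₀ hpi] at hs
  rw [hs]
  ring

lemma exp_two_arctan_mul_I (u : ℝ) :
    Complex.exp (((Real.pi + 2 * Real.arctan u : ℝ) : ℂ) * Complex.I) =
      -((1 + (u : ℂ) * Complex.I) / (1 - (u : ℂ) * Complex.I)) := by
  have hs : (0 : ℝ) < √(1 + u ^ 2) := by positivity
  have hsq : √(1 + u ^ 2) ^ 2 = 1 + u ^ 2 := Real.sq_sqrt (by positivity)
  have h1 : Complex.exp ((Real.arctan u : ℂ) * Complex.I) =
      (1 + (u : ℂ) * Complex.I) / (√(1 + u ^ 2) : ℂ) := by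
    rw [Complex.exp_mul_I, ← Complex.ofReal_cos, ← Complex.ofReal_sin, Real.cos_arctan,
      Real.sin_arctan]
    push_cast
    ring
  have h2 : Complex.exp (((Real.pi + 2 * Real.arctan u : ℝ) : ℂ) * Complex.I) =
      -(Complex.exp ((Real.arctan u : ℂ) * Complex.I)) ^ 2 := by
    rw [← Complex.exp_nat_mul, show (((Real.pi + 2 * Real.arctan u : ℝ) : ℂ) * Complex.I) =
      (Real.pi : ℂ) * Complex.I + ((2 : ℕ) : ℂ) * ((Real.arctan u : ℂ) * Complex.I) by
        push_cast; ring, Complex.exp_add, Complex.exp_pi_mul_I]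
    ring
  have h3 : ((√(1 + u ^ 2) : ℝ) : ℂ) ^ 2 =
      (1 + (u : ℂ) * Complex.I) * (1 - (u : ℂ) * Complex.I) := by
    rw [← Complex.ofReal_pow, hsq]
    push_cast
    linear_combination (u : ℂ) ^ 2 * Complex.I_sq
  rw [h2, h1, div_pow, h3]
  have := one_add_ofReal_mul_I_ne_zero u
  have := one_sub_ofReal_mul_I_ne_zero u
  field_simp

lemma integral_zero_two_pi_eq_integral_arctan (g : ℝ → ℂ) :
    ∫ θ in (0 : ℝ)..(2 * Real.pi), g θ =
      ∫ u : ℝ, (2 * (1 + u ^ 2)⁻¹) • g (Real.pi + 2 * Real.arctan u) := by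
  have himage : (fun u : ℝ => Real.pi + 2 * Real.arctan u) '' Set.univ =
      Set.Ioo 0 (2 * Real.pi) := by
    ext θ
    simp only [Set.image_univ, Set.mem_range, Set.mem_Ioo]
    constructor
    · rintro ⟨u, rfl⟩
      have := Real.neg_pi_div_two_lt_arctan u
      have := Real.arctan_lt_pi_div_two u
      constructor <;> linarith
    · rintro ⟨h1, h2⟩
      refine ⟨Real.tan ((θ - Real.pi) / 2), ?_⟩
      rw [Real.arctan_tan (by linarith) (by linarith)]
      ring
  rw [intervalIntegral.integral_of_le (by positivity), integral_Ioc_eq_integral_Ioo, ← himage,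
    integral_image_eq_integral_abs_deriv_smul MeasurableSet.univ
      (f' := fun u => 2 * (1 + u ^ 2)⁻¹), setIntegral_univ]
  · congr 1
    ext u
    rw [abs_of_pos (by positivity)]
  · intro u _
    have := ((Real.hasDerivAt_arctan u).const_mul 2).const_add Real.pi
    rw [one_div] at this
    exact this.hasDerivWithinAt
  · intro u _ v _ h
    simpa using h

/-- The Poisson integral formula on the upper half-plane, for bounded holomorphic functions that
are continuous up to the boundary except possibly at the origin. -/
lemma integral_poisson_upperHalfPlane {F : ℂ → ℂ} {M : ℝ}
    (hF : ∀ w : ℂ, 0 < w.im → DifferentiableAt ℂ F w)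
    (hM : ∀ w : ℂ, 0 < w.im → ‖F w‖ ≤ M)
    (hb : ∀ x : ℝ, x ≠ 0 →
      Filter.Tendsto F (nhdsWithin (x : ℂ) {w | 0 < w.im}) (nhds (F x))) (y : ℝ) :
    ∫ u : ℝ, ((1 + u ^ 2)⁻¹ : ℝ) • F (((y + u : ℝ)) : ℂ) =
      Real.pi * F ((y : ℂ) + Complex.I) := by
  set W : ℂ → ℂ := fun z => (y : ℂ) + Complex.I * ((1 + z) / (1 - z)) with hW
  set E : ℝ → ℂ := fun u => -((1 + (u : ℂ) * Complex.I) / (1 - (u : ℂ) * Complex.I)) with hE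
  have hne : ∀ z : ℂ, ‖z‖ < 1 → 1 - z ≠ 0 := by
    intro z hz h
    rw [← sub_eq_zero.1 h] at hz
    simp at hz
  have hWim : ∀ z : ℂ, ‖z‖ < 1 → 0 < (W z).im := by
    intro z hz
    have h1 : (W z).im = (1 - ‖z‖ ^ 2) / Complex.normSq (1 - z) := by
      rw [← Complex.normSq_eq_norm_sq]
      simp [hW, Complex.div_re, Complex.normSq_apply]
      ring
    rw [h1]
    have : 0 < Complex.normSq (1 - z) := Complex.normSq_pos.2 (hne z hz)
    have : ‖z‖ ^ 2 < 1 := by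
      have := norm_nonneg z
      nlinarith
    apply div_pos <;> linarith
  have hEn : ∀ u, ‖E u‖ = 1 := by
    intro u
    rw [hE]
    simp only
    rw [← exp_two_arctan_mul_I, Complex.norm_exp_ofReal_mul_I]
  have hEc : Continuous E := by
    rw [hE]
    exact (Continuous.div (by fun_prop) (by fun_prop) one_sub_ofReal_mul_I_ne_zero).neg
  have hrE : ∀ r ∈ Set.Ioo (0 : ℝ) 1, ∀ u, ‖(r : ℂ) * E u‖ < 1 := by
    intro r hr u
    rw [norm_mul, hEn, Complex.norm_real, Real.norm_of_nonneg hr.1.le, mul_one]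
    exact hr.2
  have hFW : ∀ z : ℂ, ‖z‖ < 1 → DifferentiableAt ℂ (fun z => F (W z)) z := by
    intro z hz
    refine DifferentiableAt.comp z (hF _ (hWim z hz)) ?_
    refine DifferentiableAt.const_add _ (DifferentiableAt.const_mul ?_ _)
    exact DifferentiableAt.div (by fun_prop) (by fun_prop) (hne z hz)
  have hmean : ∀ r ∈ Set.Ioo (0 : ℝ) 1,
      ∫ u : ℝ, ((1 + u ^ 2)⁻¹ : ℝ) • F (W (r * E u)) = Real.pi * F ((y : ℂ) + Complex.I) := by
    intro r hr
    have h1 := circleAverage_of_differentiable_on_off_countable (f := fun z => F (W z))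
      (c := 0) (R := r) Set.countable_empty (fun z hz => by
        refine (hFW z ?_).continuousAt.continuousWithinAt
        rw [mem_closedBall_zero_iff, abs_of_pos hr.1] at hz
        exact hz.trans_lt hr.2) (fun z hz => by
        refine hFW z ?_
        have := hz.1
        rw [mem_ball_zero_iff, abs_of_pos hr.1] at this
        exact this.trans hr.2)
    rw [Real.circleAverage_def, integral_zero_two_pi_eq_integral_arctan] at h1
    have h2 : W 0 = (y : ℂ) + Complex.I := by simp [hW]
    rw [h2] at h1
    rw [← h1]
    have hcm : ∀ u, circleMap 0 r (Real.pi + 2 * Real.arctan u) = r * E u := by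
      intro u
      rw [circleMap, exp_two_arctan_mul_I, zero_add]
    simp only [hcm, mul_smul, Complex.real_smul]
    rw [integral_const_mul]
    push_cast
    have : (Real.pi : ℂ) ≠ 0 := by simp [Real.pi_ne_zero]
    field_simp
  have hlim : Filter.Tendsto (fun r : ℝ => ∫ u : ℝ, ((1 + u ^ 2)⁻¹ : ℝ) • F (W (r * E u)))
      (nhdsWithin 1 (Set.Iio 1))
      (nhds (∫ u : ℝ, ((1 + u ^ 2)⁻¹ : ℝ) • F (((y + u : ℝ)) : ℂ))) := by
    have hev : ∀ᶠ r : ℝ in nhdsWithin 1 (Set.Iio 1), r ∈ Set.Ioo (0 : ℝ) 1 :=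
      Ioo_mem_nhdsLT one_pos
    refine tendsto_integral_filter_of_dominated_convergence
      (fun u : ℝ => (1 + u ^ 2)⁻¹ * M) ?_ ?_ (integrable_inv_one_add_sq.mul_const M) ?_
    · filter_upwards [hev] with r hr
      refine Continuous.aestronglyMeasurable ?_
      have hinv : Continuous fun u : ℝ => (1 + u ^ 2)⁻¹ :=
        Continuous.inv₀ (by fun_prop) fun u => by positivity
      refine hinv.smul ?_
      rw [continuous_iff_continuousAt]
      intro u
      exact ContinuousAt.comp (f := fun u : ℝ => (r : ℂ) * E u)
        (hFW _ (hrE r hr u)).continuousAt (by fun_prop)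
    · filter_upwards [hev] with r hr
      refine Filter.Eventually.of_forall fun u => ?_
      rw [norm_smul, Real.norm_of_nonneg (by positivity)]
      gcongr
      exact hM _ (hWim _ (hrE r hr u))
    · have hae : ∀ᵐ u : ℝ, u ≠ -y := by
        simp [ae_iff]
      filter_upwards [hae] with u hu
      refine Filter.Tendsto.const_smul ?_ _
      refine (hb (y + u) fun h => hu (by linarith)).comp ?_
      refine tendsto_nhdsWithin_iff.2 ⟨?_, ?_⟩
      · have h2 := one_sub_ofReal_mul_I_ne_zero u
        have hWE : W (((1 : ℝ) : ℂ) * E u) = ((y + u : ℝ) : ℂ) := by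
          have h3 : (1 : ℂ) - E u = 2 / (1 - (u : ℂ) * Complex.I) := by
            rw [hE]; field_simp; ring
          have h4 : (1 : ℂ) + E u = -2 * u * Complex.I / (1 - (u : ℂ) * Complex.I) := by
            rw [hE]; field_simp; ring
          simp only [hW, Complex.ofReal_one, one_mul, h3, h4]
          rw [div_div_div_cancel_right₀ h2]
          push_cast
          linear_combination -(u : ℂ) * Complex.I_sq
        rw [← hWE]
        have hd : (1 : ℂ) - ((1 : ℝ) : ℂ) * E u ≠ 0 := by
          rw [Complex.ofReal_one, one_mul]
          have : (1 : ℂ) - E u = 2 / (1 - (u : ℂ) * Complex.I) := by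
            rw [hE]; field_simp; ring
          rw [this]
          exact div_ne_zero two_ne_zero h2
        have hc : ContinuousAt (fun r : ℝ => W ((r : ℂ) * E u)) 1 := by
          refine ContinuousAt.add continuousAt_const (ContinuousAt.mul continuousAt_const ?_)
          exact ContinuousAt.div (by fun_prop) (by fun_prop) hd
        exact hc.tendsto.mono_left nhdsWithin_le_nhds
      · filter_upwards [hev] with r hr
        exact hWim _ (hrE r hr u)
  refine tendsto_nhds_unique hlim (tendsto_const_nhds.congr' ?_)
  filter_upwards [Ioo_mem_nhdsLT (zero_lt_one (α := ℝ))] with r hr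
  exact (hmean r hr).symm

lemma norm_cpow_imag_le {w s : ℂ} (hw : w ≠ 0) (hs : s.re = 0) :
    ‖w ^ s‖ ≤ Real.exp (Real.pi * |s.im|) := by
  rw [Complex.norm_cpow_of_ne_zero hw, hs, Real.rpow_zero, one_div, ← Real.exp_neg]
  gcongr
  calc _ ≤ |Complex.arg w * s.im| := neg_le_abs _
    _ ≤ _ := by rw [abs_mul]; gcongr; exact Complex.abs_arg_le_pi _

lemma integral_poisson_cpow {s : ℂ} (hs : s.re = 0) (y : ℝ) :
    ∫ u : ℝ, ((1 + u ^ 2)⁻¹ : ℝ) • (((y + u : ℝ) : ℂ) ^ s) =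
      Real.pi * ((y : ℂ) + Complex.I) ^ s := by
  refine integral_poisson_upperHalfPlane (F := fun w => w ^ s)
    (M := Real.exp (Real.pi * |s.im|)) (fun w hw => ?_) (fun w hw => ?_) (fun x hx => ?_) y
  · exact differentiableAt_id.cpow_const (Or.inr hw.ne')
  · exact norm_cpow_imag_le (fun h => by simp [h] at hw) hs
  · have hx' : (x : ℂ) ≠ 0 := by exact_mod_cast hx
    have hlog : ContinuousWithinAt Complex.log {w | 0 < w.im} (x : ℂ) := by
      rcases lt_or_gt_of_ne hx with h | h
      · exact (Complex.continuousWithinAt_log_of_re_neg_of_im_zero (by simpa using h)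
          (by simp)).mono fun w (hw : 0 < w.im) => hw.le
      · exact (continuousAt_clog (Or.inl (by simpa using h))).continuousWithinAt
    have : ContinuousWithinAt (fun w => Complex.exp (Complex.log w * s)) {w | 0 < w.im}
        (x : ℂ) := by fun_prop
    have h2 : Filter.Tendsto (fun w : ℂ => w ^ s) (nhdsWithin (x : ℂ) {w | 0 < w.im})
        (nhds (Complex.exp (Complex.log x * s))) := by
      refine Filter.Tendsto.congr' ?_ this
      filter_upwards [self_mem_nhdsWithin] with w hw
      rw [Complex.cpow_def_of_ne_zero fun h => by simp [h] at hw]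
    rwa [← Complex.cpow_def_of_ne_zero hx'] at h2

lemma log_ofReal_add_I (y : ℝ) :
    Complex.log ((y : ℂ) + Complex.I) =
      Complex.log ((1 : ℂ) - (y : ℂ) * Complex.I) + (Real.pi / 2 : ℝ) * Complex.I := by
  have h : (y : ℂ) + Complex.I = Complex.I * ((1 : ℂ) - (y : ℂ) * Complex.I) := by
    linear_combination (y : ℂ) * Complex.I_sq
  have h2 : |Complex.arg ((1 : ℂ) - (y : ℂ) * Complex.I)| < Real.pi / 2 :=
    Complex.abs_arg_lt_pi_div_two_iff.2 (Or.inl (by simp))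
  rw [abs_lt] at h2
  rw [h, Complex.log_mul Complex.I_ne_zero (one_sub_ofReal_mul_I_ne_zero y), Complex.log_I]
  · push_cast; ring
  · rw [Complex.arg_I]
    constructor <;> linarith

lemma abs_cpow_imag_eq (η : ℝ) {x : ℝ} (hx : x ≠ 0) :
    ((|x| : ℝ) : ℂ) ^ (-2 * (η : ℂ) * Complex.I) =
      (2 * (Real.cosh (Real.pi * η) : ℂ))⁻¹ *
      ((Real.exp (-(Real.pi * η)) : ℂ) * (x : ℂ) ^ (-2 * (η : ℂ) * Complex.I) +
        (Real.exp (Real.pi * η) : ℂ) *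
          (starRingEnd ℂ) ((x : ℂ) ^ (2 * (η : ℂ) * Complex.I))) := by
  have hx' : (x : ℂ) ≠ 0 := by exact_mod_cast hx
  have hax : ((|x| : ℝ) : ℂ) ≠ 0 := by exact_mod_cast (abs_pos.2 hx).ne'
  have hc : (2 * (Real.cosh (Real.pi * η) : ℂ)) ≠ 0 := by
    refine mul_ne_zero two_ne_zero ?_
    exact_mod_cast (Real.cosh_pos (Real.pi * η)).ne'
  rw [eq_inv_mul_iff_mul_eq₀ hc, Real.cosh_eq]
  rw [Complex.cpow_def_of_ne_zero hax, Complex.cpow_def_of_ne_zero hx',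
    Complex.cpow_def_of_ne_zero hx', ← Complex.exp_conj]
  rcases lt_or_gt_of_ne hx with h | h
  · have hl : Complex.log (x : ℂ) = ((Real.log |x| : ℝ) : ℂ) + Real.pi * Complex.I := by
      rw [Complex.log, Complex.arg_ofReal_of_neg h, Complex.norm_real, Real.norm_eq_abs]
    rw [hl, ← Complex.ofReal_log (abs_nonneg x)]
    simp only [map_mul, map_add, Complex.conj_ofReal, Complex.conj_I, map_ofNat]
    push_cast
    rw [← Complex.exp_add, ← Complex.exp_add, mul_div_cancel₀ _ two_ne_zero, add_mul,
      ← Complex.exp_add, ← Complex.exp_add]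
    congr 2
    · linear_combination (2 * (η : ℂ) * Real.pi) * Complex.I_sq
    · linear_combination (-2 * (η : ℂ) * Real.pi) * Complex.I_sq
  · rw [abs_of_pos h, ← Complex.ofReal_log h.le]
    simp only [map_mul, Complex.conj_ofReal, Complex.conj_I, map_ofNat]
    push_cast
    rw [← Complex.exp_add, ← Complex.exp_add, mul_div_cancel₀ _ two_ne_zero, add_mul,
      ← Complex.exp_add, ← Complex.exp_add, add_comm]
    congr 2
    all_goals ring

lemma integrable_inv_one_add_sq_smul_cpow {s : ℂ} (hs : s.re = 0) (y : ℝ) :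
    Integrable fun u : ℝ => ((1 + u ^ 2)⁻¹ : ℝ) • (((y + u : ℝ) : ℂ) ^ s) := by
  refine (integrable_inv_one_add_sq.mul_const (Real.exp (Real.pi * |s.im|))).mono' ?_ ?_
  · exact Measurable.aestronglyMeasurable (by fun_prop)
  · have hae : ∀ᵐ u : ℝ, u ≠ -y := by
      simp [ae_iff]
    filter_upwards [hae] with u hu
    rw [norm_smul, Real.norm_of_nonneg (by positivity)]
    gcongr
    refine norm_cpow_imag_le ?_ hs
    exact_mod_cast fun h => hu (by linarith)

/-- The Poisson integral of `|x| ^ (-2 * i * η)`. -/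
lemma integral_poisson_abs_cpow (η y : ℝ) :
    ∫ u : ℝ, ((1 + u ^ 2)⁻¹ : ℝ) • (((|y + u| : ℝ) : ℂ) ^ (-2 * (η : ℂ) * Complex.I)) =
      Real.pi * (2 * (Real.cosh (Real.pi * η) : ℂ))⁻¹ *
        (((1 : ℂ) - (y : ℂ) * Complex.I) ^ (-2 * (η : ℂ) * Complex.I) +
          ((1 : ℂ) + (y : ℂ) * Complex.I) ^ (-2 * (η : ℂ) * Complex.I)) := by
  have hs1 : (-2 * (η : ℂ) * Complex.I).re = 0 := by simp
  have hs2 : (2 * (η : ℂ) * Complex.I).re = 0 := by simp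
  have hae : ∀ᵐ u : ℝ, u ≠ -y := by
    simp [ae_iff]
  have hyI : (y : ℂ) + Complex.I ≠ 0 := fun h => by simpa using congrArg Complex.im h
  have hconj : Integrable fun u : ℝ => (starRingEnd ℂ)
      (((1 + u ^ 2)⁻¹ : ℝ) • (((y + u : ℝ) : ℂ) ^ (2 * (η : ℂ) * Complex.I))) :=
    Complex.conjCLE.integrable_comp_iff.2 (integrable_inv_one_add_sq_smul_cpow hs2 y)
  have e1 : ∫ u : ℝ, ((1 + u ^ 2)⁻¹ : ℝ) • (((|y + u| : ℝ) : ℂ) ^ (-2 * (η : ℂ) * Complex.I)) =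
      ∫ u : ℝ, ((2 * (Real.cosh (Real.pi * η) : ℂ))⁻¹ *
      ((Real.exp (-(Real.pi * η)) : ℂ) *
        (((1 + u ^ 2)⁻¹ : ℝ) • (((y + u : ℝ) : ℂ) ^ (-2 * (η : ℂ) * Complex.I))) +
        (Real.exp (Real.pi * η) : ℂ) * (starRingEnd ℂ)
          (((1 + u ^ 2)⁻¹ : ℝ) • (((y + u : ℝ) : ℂ) ^ (2 * (η : ℂ) * Complex.I))))) := by
    refine integral_congr_ae ?_
    filter_upwards [hae] with u hu
    rw [abs_cpow_imag_eq η (x := y + u) fun h => hu (by linarith)]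
    simp only [Complex.real_smul, map_mul, Complex.conj_ofReal]
    ring
  rw [e1, integral_const_mul, integral_add
    ((integrable_inv_one_add_sq_smul_cpow hs1 y).const_mul _)
    (hconj.const_mul _), integral_const_mul, integral_const_mul,
    integral_conj, integral_poisson_cpow hs1, integral_poisson_cpow hs2]
  rw [Complex.cpow_def_of_ne_zero hyI, Complex.cpow_def_of_ne_zero hyI, map_mul,
    ← Complex.exp_conj, log_ofReal_add_I,
    Complex.cpow_def_of_ne_zero (one_add_ofReal_mul_I_ne_zero y),
    Complex.cpow_def_of_ne_zero (one_sub_ofReal_mul_I_ne_zero y), log_one_sub_ofReal_mul_I]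
  simp only [map_mul, map_add, Complex.conj_conj, Complex.conj_ofReal, Complex.conj_I, map_ofNat]
  set L := Complex.log ((1 : ℂ) + (y : ℂ) * Complex.I)
  have f1 : (Real.exp (-(Real.pi * η)) : ℂ) *
      Complex.exp (((starRingEnd ℂ) L + (Real.pi / 2 : ℝ) * Complex.I) *
        (-2 * (η : ℂ) * Complex.I)) =
      Complex.exp ((starRingEnd ℂ) L * (-2 * (η : ℂ) * Complex.I)) := by
    push_cast
    rw [← Complex.exp_add]
    congr 1
    linear_combination (-(η : ℂ) * Real.pi) * Complex.I_sq
  have f2 : (Real.exp (Real.pi * η) : ℂ) *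
      Complex.exp ((L + (Real.pi / 2 : ℝ) * -Complex.I) * (2 * (η : ℂ) * -Complex.I)) =
      Complex.exp (L * (-2 * (η : ℂ) * Complex.I)) := by
    push_cast
    rw [← Complex.exp_add]
    congr 1
    linear_combination ((η : ℂ) * Real.pi) * Complex.I_sq
  rw [← f1, ← f2]
  ring

lemma image_sub_div_compl_singleton (u : ℝ) :
    (fun w : ℝ => u - (1 + u ^ 2) / w) '' {0}ᶜ = {u}ᶜ := by
  have hA : (1 + u ^ 2 : ℝ) ≠ 0 := by positivity
  ext t
  simp only [Set.mem_image, Set.mem_compl_iff, Set.mem_singleton_iff]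
  constructor
  · rintro ⟨w, hw, rfl⟩ h
    have : (1 + u ^ 2) / w = 0 := by linarith
    exact div_ne_zero hA hw this
  · intro h
    have h' : u - t ≠ 0 := fun h0 => h (by linarith)
    refine ⟨(1 + u ^ 2) / (u - t), div_ne_zero hA h', ?_⟩
    rw [div_div_cancel₀ hA]
    ring

lemma hasDerivWithinAt_sub_div (u : ℝ) :
    ∀ w ∈ ({0}ᶜ : Set ℝ), HasDerivWithinAt (fun w : ℝ => u - (1 + u ^ 2) / w)
      ((1 + u ^ 2) / w ^ 2) {0}ᶜ w := by
  intro w hw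
  have h := ((hasDerivAt_inv hw).const_mul (1 + u ^ 2)).const_sub u
  have e : -((1 + u ^ 2) * -(w ^ 2)⁻¹) = (1 + u ^ 2) / w ^ 2 := by ring
  rw [e] at h
  exact h.hasDerivWithinAt

lemma injOn_sub_div (u : ℝ) :
    Set.InjOn (fun w : ℝ => u - (1 + u ^ 2) / w) {0}ᶜ := by
  intro v hv w hw h
  have hA : (1 + u ^ 2 : ℝ) ≠ 0 := by positivity
  simpa [div_eq_mul_inv, hA] using h

lemma restrict_compl_singleton_volume (x : ℝ) :
    (volume : Measure ℝ).restrict {x}ᶜ = volume :=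
  Measure.restrict_eq_self_of_ae_mem (by simp [ae_iff])

/-- Integrals over the real line are transformed by the rotation `y ↦ (u * y - 1) / (y + u)`. -/
lemma integral_eq_integral_rotation {E : Type*} [NormedAddCommGroup E] [NormedSpace ℝ E]
    (u : ℝ) (g : ℝ → E) :
    ∫ t, g t = ∫ y : ℝ, ((1 + u ^ 2) / (y + u) ^ 2) • g (u - (1 + u ^ 2) / (y + u)) := by
  have h := integral_image_eq_integral_abs_deriv_smul (measurableSet_singleton (0 : ℝ)).compl
    (hasDerivWithinAt_sub_div u) (injOn_sub_div u) g
  rw [image_sub_div_compl_singleton, restrict_compl_singleton_volume,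
    restrict_compl_singleton_volume] at h
  rw [h, ← integral_add_right_eq_self _ u]
  congr 1
  ext y
  rw [abs_of_nonneg (by positivity)]

lemma integrable_iff_integrable_rotation {E : Type*} [NormedAddCommGroup E] [NormedSpace ℝ E]
    (u : ℝ) (g : ℝ → E) :
    Integrable g ↔ Integrable fun y : ℝ =>
      ((1 + u ^ 2) / (y + u) ^ 2) • g (u - (1 + u ^ 2) / (y + u)) := by
  have h := integrableOn_image_iff_integrableOn_abs_deriv_smul
    (measurableSet_singleton (0 : ℝ)).compl
    (hasDerivWithinAt_sub_div u) (injOn_sub_div u) g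
  rw [image_sub_div_compl_singleton, IntegrableOn, IntegrableOn, restrict_compl_singleton_volume,
    restrict_compl_singleton_volume] at h
  have e : (fun w : ℝ => |(1 + u ^ 2) / w ^ 2| • g (u - (1 + u ^ 2) / w)) =
      fun w : ℝ => ((1 + u ^ 2) / w ^ 2) • g (u - (1 + u ^ 2) / w) := by
    ext w
    rw [abs_of_nonneg (by positivity)]
  rw [h, e]
  refine ⟨fun h => h.comp_add_right u, fun h => ?_⟩
  simpa using h.comp_sub_right u

lemma integrable_and_integral_eq_of_rotation {F H : ℝ × ℝ → ℂ}
    (hF : AEStronglyMeasurable F) (hH : Integrable H)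
    (h : ∀ u : ℝ, (fun y : ℝ => ((1 + u ^ 2) / (y + u) ^ 2) •
      F (u - (1 + u ^ 2) / (y + u), u)) =ᵐ[volume] fun y => H (y, u)) :
    Integrable F ∧ ∫ p, F p = ∫ p, H p := by
  rw [Measure.volume_eq_prod] at hF hH ⊢
  have hFi : Integrable F ((volume : Measure ℝ).prod (volume : Measure ℝ)) := by
    rw [integrable_prod_iff' hF]
    constructor
    · filter_upwards [hH.prod_left_ae] with u hu
      rw [integrable_iff_integrable_rotation u]
      exact hu.congr (h u).symm
    · refine hH.integral_norm_prod_right.congr (Filter.Eventually.of_forall fun u => ?_)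
      simp only
      rw [integral_eq_integral_rotation u fun t => ‖F (t, u)‖]
      refine integral_congr_ae ?_
      filter_upwards [h u] with y hy
      rw [← hy, norm_smul, Real.norm_of_nonneg (by positivity), smul_eq_mul]
  refine ⟨hFi, ?_⟩
  rw [integral_prod_symm _ hFi, integral_prod_symm _ hH]
  congr 1
  ext u
  rw [integral_eq_integral_rotation u fun t => F (t, u)]
  exact integral_congr_ae (h u)

lemma ofReal_cpow_eq_exp_log {x : ℝ} (hx : 0 < x) (s : ℂ) :
    (x : ℂ) ^ s = Complex.exp ((Real.log x : ℂ) * s) := by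
  rw [Complex.cpow_def_of_ne_zero (by exact_mod_cast hx.ne'), Complex.ofReal_log hx.le]

lemma one_add_mul_one_sub_cpow (t : ℝ) (s : ℂ) :
    ((1 : ℂ) + (t : ℂ) * Complex.I) ^ s * ((1 : ℂ) - (t : ℂ) * Complex.I) ^ s =
      ((1 + t ^ 2 : ℝ) : ℂ) ^ s := by
  rw [Complex.cpow_def_of_ne_zero (one_add_ofReal_mul_I_ne_zero t),
    Complex.cpow_def_of_ne_zero (one_sub_ofReal_mul_I_ne_zero t), ← Complex.exp_add, ← add_mul,
    log_one_sub_ofReal_mul_I, Complex.add_conj, Complex.log_re, norm_one_add_ofReal_mul_I,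
    Real.log_rpow (by positivity), ofReal_cpow_eq_exp_log (by positivity)]
  congr 2
  push_cast
  ring

lemma fz_add_self (ζ : ℂ) (k : ℤ) (t : ℝ) :
    fz ζ (k + k) t = (Real.pi : ℂ) ^ (-(1/2) : ℂ) * ((1 + t ^ 2 : ℝ) : ℂ) ^ (ζ - 1/2) *
      (((1 : ℂ) + (t : ℂ) * Complex.I) / ((1 : ℂ) - (t : ℂ) * Complex.I)) ^ k := by
  have hk : (((k + k : ℤ) : ℂ)) / 2 = (k : ℂ) := by push_cast; ring
  rw [fz, hk, Complex.cpow_add _ _ (one_add_ofReal_mul_I_ne_zero t),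
    Complex.cpow_sub _ _ (one_sub_ofReal_mul_I_ne_zero t), Complex.cpow_intCast,
    Complex.cpow_intCast, ← one_add_mul_one_sub_cpow, div_zpow]
  ring

lemma fz_rotation (ξ η y u : ℝ) (k : ℤ) (h : y + u ≠ 0) :
    ((1 + u ^ 2) / (y + u) ^ 2) •
      (fz (ξ + η * Complex.I) (k + k) (u - (1 + u ^ 2) / (y + u)) *
        fz (ξ - η * Complex.I) (-(k + k)) u *
        ((|u - (1 + u ^ 2) / (y + u) - u| ^ (-2 * ξ - 1) : ℝ) : ℂ)) =
    (Real.pi : ℂ) ^ (-(1/2) : ℂ) * (-1) ^ k * fz (ξ + η * Complex.I) (k + k) y *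
      (((1 + u ^ 2)⁻¹ : ℝ) • (((|y + u| : ℝ) : ℂ) ^ (-2 * (η : ℂ) * Complex.I))) := by
  set t := u - (1 + u ^ 2) / (y + u) with ht
  have hw : 0 < |y + u| := abs_pos.2 h
  have hU : 0 < 1 + u ^ 2 := by positivity
  have hX : 0 < 1 + y ^ 2 := by positivity
  have h2 : t * (y + u) = u * y - 1 := by
    rw [ht]; field_simp; ring
  have h2c : (t : ℂ) * ((y : ℂ) + u) = u * y - 1 := by exact_mod_cast h2
  have hc : (y : ℂ) + u ≠ 0 := by exact_mod_cast h
  have e1 : 1 + t ^ 2 = (1 + y ^ 2) * (1 + u ^ 2) / |y + u| ^ 2 := by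
    rw [sq_abs, eq_div_iff (by positivity)]
    linear_combination (t * (y + u) + u * y - 1) * h2
  have l1 : Real.log (1 + t ^ 2) =
      Real.log (1 + y ^ 2) + Real.log (1 + u ^ 2) - 2 * Real.log |y + u| := by
    rw [e1, Real.log_div (by positivity) (by positivity), Real.log_mul hX.ne' hU.ne',
      Real.log_pow]
    norm_num
  have e2 : |t - u| = (1 + u ^ 2) / |y + u| := by
    rw [ht, sub_sub_cancel_left, abs_neg, abs_div, abs_of_pos hU]
  have l2 : Real.log |t - u| = Real.log (1 + u ^ 2) - Real.log |y + u| := by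
    rw [e2, Real.log_div hU.ne' hw.ne']
  have e3 : ((1 : ℂ) + (t : ℂ) * Complex.I) / ((1 : ℂ) - (t : ℂ) * Complex.I) =
      -1 * (((1 : ℂ) + (y : ℂ) * Complex.I) / ((1 : ℂ) - (y : ℂ) * Complex.I)) *
        (((1 : ℂ) + (u : ℂ) * Complex.I) / ((1 : ℂ) - (u : ℂ) * Complex.I)) := by
    have hy := one_sub_ofReal_mul_I_ne_zero y
    have hu := one_sub_ofReal_mul_I_ne_zero u
    have htn := one_sub_ofReal_mul_I_ne_zero t
    have p1 : ((1 : ℂ) + (t : ℂ) * Complex.I) * (y + u) =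
        -Complex.I * (((1 : ℂ) + (y : ℂ) * Complex.I) * ((1 : ℂ) + (u : ℂ) * Complex.I)) := by
      linear_combination Complex.I * h2c + (y + u + u * y * Complex.I) * Complex.I_sq
    have p2 : ((1 : ℂ) - (t : ℂ) * Complex.I) * (y + u) =
        Complex.I * (((1 : ℂ) - (y : ℂ) * Complex.I) * ((1 : ℂ) - (u : ℂ) * Complex.I)) := by
      linear_combination -Complex.I * h2c + (y + u - u * y * Complex.I) * Complex.I_sq
    rw [← mul_div_mul_right _ _ hc, p1, p2]
    have := Complex.I_ne_zero
    field_simp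
  have hEu : ((1 : ℂ) + (u : ℂ) * Complex.I) / ((1 : ℂ) - (u : ℂ) * Complex.I) ≠ 0 :=
    div_ne_zero (one_add_ofReal_mul_I_ne_zero u) (one_sub_ofReal_mul_I_ne_zero u)
  have htu : 0 < |t - u| := by rw [e2]; positivity
  have hA : ((1 + u ^ 2 : ℝ) : ℂ) = Complex.exp (Real.log (1 + u ^ 2) : ℂ) := by
    rw [← Complex.ofReal_exp, Real.exp_log hU]
  have hB : ((|y + u| : ℝ) : ℂ) = Complex.exp (Real.log |y + u| : ℂ) := by
    rw [← Complex.ofReal_exp, Real.exp_log hw]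
  have hneg : -(k + k) = -k + -k := by ring
  rw [hneg, fz_add_self, fz_add_self, fz_add_self, e3, mul_zpow, mul_zpow, zpow_neg,
    Complex.real_smul, Complex.real_smul, Complex.ofReal_cpow (abs_nonneg _),
    ofReal_cpow_eq_exp_log htu, ofReal_cpow_eq_exp_log hw, ofReal_cpow_eq_exp_log hX,
    ofReal_cpow_eq_exp_log hU, ofReal_cpow_eq_exp_log (x := 1 + t ^ 2) (by positivity), l1, l2,
    ← sq_abs (y + u), Complex.ofReal_div, Complex.ofReal_inv, Complex.ofReal_pow, hA, hB,
    ← Complex.exp_neg, ← Complex.exp_nat_mul, ← Complex.exp_sub]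
  have hEk := zpow_ne_zero k hEu
  set Eu := (((1 : ℂ) + (u : ℂ) * Complex.I) / ((1 : ℂ) - (u : ℂ) * Complex.I)) ^ k
  set Ey := (((1 : ℂ) + (y : ℂ) * Complex.I) / ((1 : ℂ) - (y : ℂ) * Complex.I)) ^ k
  set U := Real.log (1 + u ^ 2)
  set Y := Real.log (1 + y ^ 2)
  set V := Real.log |y + u|
  set P := (Real.pi : ℂ) ^ (-(1/2) : ℂ)
  have key : Complex.exp ((U : ℂ) - (2 : ℕ) * V) *
      Complex.exp (((Y + U - 2 * V : ℝ) : ℂ) * ((ξ : ℂ) + η * Complex.I - 1 / 2)) *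
      Complex.exp ((U : ℂ) * ((ξ : ℂ) - η * Complex.I - 1 / 2)) *
      Complex.exp (((U - V : ℝ) : ℂ) * ((-2 * ξ - 1 : ℝ) : ℂ)) =
      Complex.exp ((Y : ℂ) * ((ξ : ℂ) + η * Complex.I - 1 / 2)) * Complex.exp (-(U : ℂ)) *
        Complex.exp ((V : ℂ) * (-2 * (η : ℂ) * Complex.I)) := by
    simp only [← Complex.exp_add]
    congr 1
    push_cast
    ring
  have hEE : Eu * Eu⁻¹ = 1 := mul_inv_cancel₀ hEk
  linear_combination (P * P * (-1) ^ k * Ey) * key + (P * P * (-1) ^ k * Ey) *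
    (Complex.exp ((U : ℂ) - (2 : ℕ) * V) *
      Complex.exp (((Y + U - 2 * V : ℝ) : ℂ) * ((ξ : ℂ) + η * Complex.I - 1 / 2)) *
      Complex.exp ((U : ℂ) * ((ξ : ℂ) - η * Complex.I - 1 / 2)) *
      Complex.exp (((U - V : ℝ) : ℂ) * ((-2 * ξ - 1 : ℝ) : ℂ))) * hEE

lemma integrable_one_add_cpow_mul_one_sub_cpow {p q : ℂ} (h : (p + q).re < -1) :
    Integrable fun y : ℝ =>
      ((1 : ℂ) + (y : ℂ) * Complex.I) ^ p * ((1 : ℂ) - (y : ℂ) * Complex.I) ^ q := by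
  refine ((integrable_one_add_sq_rpow h).const_mul
    (Real.exp (Real.pi * |p.im|) * Real.exp (Real.pi * |q.im|))).mono'
    ((continuous_one_add_ofReal_mul_I_cpow p).mul
      (continuous_one_sub_ofReal_mul_I_cpow q)).aestronglyMeasurable
    (Filter.Eventually.of_forall fun y => ?_)
  have h1 := norm_one_add_ofReal_mul_I_cpow_le y p
  have h2 := norm_one_add_ofReal_mul_I_cpow_le (-y) q
  rw [Complex.ofReal_neg, neg_mul, ← sub_eq_add_neg, neg_sq] at h2
  rw [norm_mul, Complex.add_re, add_div, Real.rpow_add (by positivity)]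
  calc _ ≤ _ := mul_le_mul h1 h2 (norm_nonneg _) (by positivity)
    _ = _ := by ring

lemma measurable_fz (ζ : ℂ) (μ : ℤ) : Measurable (fz ζ μ) :=
  (((continuous_one_add_ofReal_mul_I_cpow _).measurable.const_mul _).mul
    (continuous_one_sub_ofReal_mul_I_cpow _).measurable)

lemma integrable_fz {ζ : ℂ} (μ : ℤ) (h : ζ.re < 0) : Integrable (fz ζ μ) := by
  have := (integrable_one_add_cpow_mul_one_sub_cpow
    (p := ζ - 1 / 2 + (μ : ℂ) / 2) (q := ζ - 1 / 2 - (μ : ℂ) / 2) (by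
      have e : ζ - 1 / 2 + (μ : ℂ) / 2 + (ζ - 1 / 2 - (μ : ℂ) / 2) = (2 : ℝ) * ζ - (1 : ℝ) := by
        push_cast; ring
      rw [e, Complex.sub_re, Complex.re_ofReal_mul, Complex.ofReal_re]
      linarith)).const_mul ((Real.pi : ℂ) ^ (-(1/2) : ℂ))
  refine this.congr (Filter.Eventually.of_forall fun y => ?_)
  simp only [fz, mul_assoc]

lemma norm_abs_cpow_imag_le {x : ℝ} (hx : x ≠ 0) (η : ℝ) :
    ‖((|x| : ℝ) : ℂ) ^ (-2 * (η : ℂ) * Complex.I)‖ ≤ 1 := by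
  rw [Complex.norm_cpow_eq_rpow_re_of_pos (abs_pos.2 hx)]
  simp

lemma integrable_fz_mul_poisson {ξ : ℝ} (h : ξ < 0) (η : ℝ) (μ : ℤ) :
    Integrable fun p : ℝ × ℝ => fz (ξ + η * Complex.I) μ p.1 *
      (((1 + p.2 ^ 2)⁻¹ : ℝ) • (((|p.1 + p.2| : ℝ) : ℂ) ^ (-2 * (η : ℂ) * Complex.I))) := by
  have h1 : Integrable (fz (ξ + η * Complex.I) μ) := integrable_fz μ (by simpa using h)
  refine (h1.norm.mul_prod integrable_inv_one_add_sq).mono' ?_ ?_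
  · have := measurable_fz (ξ + η * Complex.I) μ
    refine Measurable.aestronglyMeasurable ?_
    have h2 : Measurable fun p : ℝ × ℝ => (1 + p.2 ^ 2)⁻¹ := by fun_prop
    have h3 : Measurable fun p : ℝ × ℝ =>
        ((|p.1 + p.2| : ℝ) : ℂ) ^ (-2 * (η : ℂ) * Complex.I) :=
      Measurable.pow_const (by fun_prop) _
    exact (this.comp measurable_fst).mul (h2.smul h3)
  · have hne : ∀ᵐ p : ℝ × ℝ, p.1 + p.2 ≠ 0 := by
      rw [Measure.volume_eq_prod]
      refine (Measure.ae_prod_iff_ae_ae ?_).2 (Filter.Eventually.of_forall fun y => ?_)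
      · exact (measurableSet_eq_fun (by fun_prop) (by fun_prop)).compl
      · filter_upwards [Measure.ae_ne volume (-y)] with u hu h0
        exact hu (by linarith)
    filter_upwards [hne] with p hp
    rw [norm_mul, norm_smul, Real.norm_of_nonneg (by positivity)]
    refine mul_le_mul_of_nonneg_left ?_ (norm_nonneg _)
    exact mul_le_of_le_one_right (by positivity) (norm_abs_cpow_imag_le hp η)

lemma pi_cpow_neg_half_mul_self :
    (Real.pi : ℂ) ^ (-(1/2) : ℂ) * (Real.pi : ℂ) ^ (-(1/2) : ℂ) = (Real.pi : ℂ)⁻¹ := by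
  rw [← Complex.cpow_add _ _ (by exact_mod_cast Real.pi_ne_zero), ← Complex.cpow_neg_one]
  norm_num

lemma integral_fz_mul_poisson {ξ : ℝ} (h : ξ < 0) (η : ℝ) (k : ℤ) :
    (Real.pi : ℂ) ^ (-(1/2) : ℂ) * ∫ p : ℝ × ℝ, fz (ξ + η * Complex.I) (k + k) p.1 *
      (((1 + p.2 ^ 2)⁻¹ : ℝ) • (((|p.1 + p.2| : ℝ) : ℂ) ^ (-2 * (η : ℂ) * Complex.I))) =
    Real.pi * (2 : ℂ) ^ (2 * (ξ : ℂ)) * Complex.Gamma (-2 * (ξ : ℂ)) *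
      ((Real.cosh (Real.pi * η) : ℂ))⁻¹ *
      ((Complex.Gamma (1 / 2 - (ξ + η * Complex.I) - k))⁻¹ *
          (Complex.Gamma (1 / 2 - (ξ - η * Complex.I) + k))⁻¹ +
        (Complex.Gamma (1 / 2 - (ξ - η * Complex.I) - k))⁻¹ *
          (Complex.Gamma (1 / 2 - (ξ + η * Complex.I) + k))⁻¹) := by
  have hc : 1 < (1 - 2 * (ξ : ℂ)).re := by
    have e : (1 - 2 * (ξ : ℂ)) = ((1 - 2 * ξ : ℝ) : ℂ) := by push_cast; ring
    rw [e, Complex.ofReal_re]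
    linarith
  have beta := fun s : ℂ =>
    integral_one_add_cpow_mul_one_sub_cpow hc (1 / 2 - s - k)
  have int := fun s : ℂ => integrable_one_add_cpow_mul_one_sub_cpow
    (p := -(1 / 2 - s - k)) (q := -(1 - 2 * (ξ : ℂ) - (1 / 2 - s - k))) (by
      rw [← neg_add, add_sub_cancel, Complex.neg_re]
      linarith)
  have hp := integrable_fz_mul_poisson h η (k + k)
  rw [Measure.volume_eq_prod] at hp ⊢
  rw [integral_prod _ hp]
  simp only [integral_const_mul, integral_poisson_abs_cpow]
  have hy : ∀ y : ℝ, fz (ξ + η * Complex.I) (k + k) y *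
      (Real.pi * (2 * (Real.cosh (Real.pi * η) : ℂ))⁻¹ *
        (((1 : ℂ) - (y : ℂ) * Complex.I) ^ (-2 * (η : ℂ) * Complex.I) +
          ((1 : ℂ) + (y : ℂ) * Complex.I) ^ (-2 * (η : ℂ) * Complex.I))) =
      (Real.pi : ℂ) ^ (-(1/2) : ℂ) * (Real.pi * (2 * (Real.cosh (Real.pi * η) : ℂ))⁻¹) *
      (((1 : ℂ) + (y : ℂ) * Complex.I) ^ (-(1 / 2 - (ξ + η * Complex.I) - k)) *
        ((1 : ℂ) - (y : ℂ) * Complex.I) ^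
          (-(1 - 2 * (ξ : ℂ) - (1 / 2 - (ξ + η * Complex.I) - k))) +
      ((1 : ℂ) + (y : ℂ) * Complex.I) ^ (-(1 / 2 - (ξ - η * Complex.I) - k)) *
        ((1 : ℂ) - (y : ℂ) * Complex.I) ^
          (-(1 - 2 * (ξ : ℂ) - (1 / 2 - (ξ - η * Complex.I) - k)))) := by
    intro y
    have e1 : -(1 - 2 * (ξ : ℂ) - (1 / 2 - (ξ + η * Complex.I) - k)) =
        (ξ + η * Complex.I - 1 / 2 - k) + -2 * (η : ℂ) * Complex.I := by ring
    have e2 : -(1 / 2 - (ξ - η * Complex.I) - k) =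
        (ξ + η * Complex.I - 1 / 2 + k) + -2 * (η : ℂ) * Complex.I := by ring
    have e3 : -(1 / 2 - (ξ + η * Complex.I) - k) = ξ + η * Complex.I - 1 / 2 + k := by ring
    have e4 : -(1 - 2 * (ξ : ℂ) - (1 / 2 - (ξ - η * Complex.I) - k)) =
        ξ + η * Complex.I - 1 / 2 - k := by ring
    have hk : (((k + k : ℤ) : ℂ)) / 2 = (k : ℂ) := by push_cast; ring
    rw [e1, e2, e3, e4,
      Complex.cpow_add _ (-2 * (η : ℂ) * Complex.I) (one_add_ofReal_mul_I_ne_zero y),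
      Complex.cpow_add _ (-2 * (η : ℂ) * Complex.I) (one_sub_ofReal_mul_I_ne_zero y), fz, hk]
    ring
  simp only [hy]
  rw [integral_const_mul, integral_add (int _) (int _), beta, beta]
  have g1 : 1 - 2 * (ξ : ℂ) - (1 / 2 - (ξ + η * Complex.I) - k) =
      1 / 2 - (ξ - η * Complex.I) + k := by ring
  have g2 : 1 - 2 * (ξ : ℂ) - (1 / 2 - (ξ - η * Complex.I) - k) =
      1 / 2 - (ξ + η * Complex.I) + k := by ring
  have g3 : 1 - 2 * (ξ : ℂ) - 1 = -2 * ξ := by ring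
  have g4 : 1 - (1 - 2 * (ξ : ℂ)) = 2 * ξ := by ring
  have hpi : (Real.pi : ℂ) * (Real.pi : ℂ)⁻¹ = 1 :=
    mul_inv_cancel₀ (by exact_mod_cast Real.pi_ne_zero)
  rw [g1, g2, g3, g4, ← mul_assoc, ← mul_assoc, pi_cpow_neg_half_mul_self, mul_inv]
  linear_combination (Real.pi * (2 : ℂ) ^ (2 * (ξ : ℂ)) * Complex.Gamma (-2 * (ξ : ℂ)) *
      ((Real.cosh (Real.pi * η) : ℂ))⁻¹ *
      ((Complex.Gamma (1 / 2 - (ξ + η * Complex.I) - k))⁻¹ *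
          (Complex.Gamma (1 / 2 - (ξ - η * Complex.I) + k))⁻¹ +
        (Complex.Gamma (1 / 2 - (ξ - η * Complex.I) - k))⁻¹ *
          (Complex.Gamma (1 / 2 - (ξ + η * Complex.I) + k))⁻¹)) * hpi

lemma cos_pi_mul_sub_mul_I {ξ : ℝ} (η : ℝ) (h : Real.cos (Real.pi * ξ) ≠ 0) :
    Complex.cos (Real.pi * (ξ - η * Complex.I)) =
      (Real.cos (Real.pi * ξ) : ℂ) * (Real.cosh (Real.pi * η) : ℂ) *
        (1 + Complex.I * (Real.tan (Real.pi * ξ) : ℂ) * (Real.tanh (Real.pi * η) : ℂ)) := by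
  have h1 : (Real.cos (Real.pi * ξ) : ℂ) ≠ 0 := by exact_mod_cast h
  have h2 : (Real.cosh (Real.pi * η) : ℂ) ≠ 0 := by exact_mod_cast (Real.cosh_pos _).ne'
  have e : (Real.pi : ℂ) * (ξ - η * Complex.I) =
      ((Real.pi * ξ : ℝ) : ℂ) - ((Real.pi * η : ℝ) : ℂ) * Complex.I := by push_cast; ring
  rw [e, Complex.cos_sub, Complex.cos_mul_I, Complex.sin_mul_I, Real.tan_eq_sin_div_cos,
    Real.tanh_eq_sinh_div_cosh, Complex.ofReal_div, Complex.ofReal_div, ← Complex.ofReal_cos,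
    ← Complex.ofReal_sin, ← Complex.ofReal_cosh, ← Complex.ofReal_sinh]
  field_simp

lemma sin_pi_mul_half_add_add_int (z : ℂ) (k : ℤ) :
    Complex.sin (Real.pi * (1 / 2 + z + k)) = (-1) ^ k * Complex.cos (Real.pi * z) := by
  have e : (Real.pi : ℂ) * (1 / 2 + z + k) = Real.pi * z + Real.pi / 2 + k * Real.pi := by ring
  rw [e, Complex.sin_antiperiodic.add_int_mul_eq, Complex.sin_add_pi_div_two, Int.cast_negOnePow]

lemma inv_Gamma_one_sub {z : ℂ} (hs : Complex.sin (Real.pi * z) ≠ 0) :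
    (Complex.Gamma (1 - z))⁻¹ * Real.pi = Complex.Gamma z * Complex.sin (Real.pi * z) := by
  have h := Complex.Gamma_mul_Gamma_one_sub z
  have hpi : (Real.pi : ℂ) ≠ 0 := by exact_mod_cast Real.pi_ne_zero
  have hg : Complex.Gamma (1 - z) ≠ 0 := by
    intro h0
    rw [h0, mul_zero] at h
    exact div_ne_zero hpi hs h.symm
  rw [eq_div_iff hs] at h
  rw [inv_mul_eq_iff_eq_mul₀ hg]
  linear_combination -h

lemma cos_pi_mul_sub_mul_I_ne_zero {ξ : ℝ} (η : ℝ) (h : Real.cos (Real.pi * ξ) ≠ 0) :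
    Complex.cos (Real.pi * (ξ - η * Complex.I)) ≠ 0 := by
  rw [cos_pi_mul_sub_mul_I η h]
  refine mul_ne_zero (mul_ne_zero (by exact_mod_cast h)
    (by exact_mod_cast (Real.cosh_pos _).ne')) fun h0 => ?_
  have e : (1 : ℂ) + Complex.I * (Real.tan (Real.pi * ξ) : ℂ) * (Real.tanh (Real.pi * η) : ℂ) =
      ((1 : ℝ) : ℂ) +
        ((Real.tan (Real.pi * ξ) * Real.tanh (Real.pi * η) : ℝ) : ℂ) * Complex.I := by
    push_cast
    ring
  rw [e] at h0
  have := congrArg Complex.re h0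
  rw [Complex.add_re, Complex.ofReal_re, Complex.re_ofReal_mul, Complex.I_re] at this
  norm_num at this

lemma inv_Gamma_mul_inv_Gamma {ξ : ℝ} (η : ℝ) (h : Real.cos (Real.pi * ξ) ≠ 0) (k : ℤ) :
    (-1) ^ k * (Real.pi : ℂ) * ((Complex.Gamma (1 / 2 - (ξ - η * Complex.I) - k))⁻¹ *
        (Complex.Gamma (1 / 2 - (ξ + η * Complex.I) + k))⁻¹) =
      (Real.cos (Real.pi * ξ) : ℂ) * (Real.cosh (Real.pi * η) : ℂ) *
        (Complex.Gamma (1 / 2 + (ξ - η * Complex.I) + k) /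
          Complex.Gamma (1 / 2 - (ξ + η * Complex.I) + k) *
        (1 + Complex.I * (Real.tan (Real.pi * ξ) : ℂ) * (Real.tanh (Real.pi * η) : ℂ))) := by
  have hs := sin_pi_mul_half_add_add_int (ξ - η * Complex.I) k
  have hsq : ((-1 : ℂ) ^ k) * (-1) ^ k = 1 := by
    rw [← mul_zpow]; norm_num
  have h1 : Complex.sin (Real.pi * (1 / 2 + (ξ - η * Complex.I) + k)) ≠ 0 := by
    rw [hs]
    exact mul_ne_zero (zpow_ne_zero _ (by norm_num)) (cos_pi_mul_sub_mul_I_ne_zero η h)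
  have h2 := inv_Gamma_one_sub h1
  have e : (1 : ℂ) - (1 / 2 + (ξ - η * Complex.I) + k) = 1 / 2 - (ξ - η * Complex.I) - k := by
    ring
  rw [e, hs, cos_pi_mul_sub_mul_I η h] at h2
  set C := (Real.cos (Real.pi * ξ) : ℂ) * (Real.cosh (Real.pi * η) : ℂ)
  set D := (1 : ℂ) + Complex.I * (Real.tan (Real.pi * ξ) : ℂ) * (Real.tanh (Real.pi * η) : ℂ)
  set G := Complex.Gamma (1 / 2 + (ξ - η * Complex.I) + k)
  set J := Complex.Gamma (1 / 2 - (ξ + η * Complex.I) + k)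
  set L := Complex.Gamma (1 / 2 - (ξ - η * Complex.I) - k)
  rw [div_eq_mul_inv]
  linear_combination (-1) ^ k * J⁻¹ * h2 + C * D * G * J⁻¹ * hsq

lemma sum_inv_Gamma_mul_inv_Gamma {ξ : ℝ} (η : ℝ) (h : Real.cos (Real.pi * ξ) ≠ 0) (k : ℤ) :
    (-1) ^ k * (Real.pi : ℂ) * ((Complex.Gamma (1 / 2 - (ξ + η * Complex.I) - k))⁻¹ *
          (Complex.Gamma (1 / 2 - (ξ - η * Complex.I) + k))⁻¹ +
        (Complex.Gamma (1 / 2 - (ξ - η * Complex.I) - k))⁻¹ *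
          (Complex.Gamma (1 / 2 - (ξ + η * Complex.I) + k))⁻¹) =
      2 * (Real.cos (Real.pi * ξ) : ℂ) * (Real.cosh (Real.pi * η) : ℂ) *
        (((Complex.Gamma (1 / 2 + (ξ - η * Complex.I) + k) /
          Complex.Gamma (1 / 2 - (ξ + η * Complex.I) + k) *
        (1 + Complex.I * (Real.tan (Real.pi * ξ) : ℂ) *
          (Real.tanh (Real.pi * η) : ℂ))).re : ℝ) : ℂ) := by
  have h1 := inv_Gamma_mul_inv_Gamma η h k
  set R := Complex.Gamma (1 / 2 + (ξ - η * Complex.I) + k) /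
          Complex.Gamma (1 / 2 - (ξ + η * Complex.I) + k) *
        (1 + Complex.I * (Real.tan (Real.pi * ξ) : ℂ) * (Real.tanh (Real.pi * η) : ℂ))
  have h2 := congrArg (starRingEnd ℂ) h1
  have e1 : (starRingEnd ℂ) (1 / 2 - (ξ - η * Complex.I) - k) =
      1 / 2 - (ξ + η * Complex.I) - k := by
    simp [map_ofNat]
  have e2 : (starRingEnd ℂ) (1 / 2 - (ξ + η * Complex.I) + k) =
      1 / 2 - (ξ - η * Complex.I) + k := by
    simp [sub_eq_add_neg, map_ofNat]
  simp only [map_mul, map_inv₀, ← Complex.Gamma_conj, e1, e2, Complex.conj_ofReal, map_zpow₀,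
    map_neg, map_one] at h2
  have h3 := Complex.add_conj R
  rw [Complex.ofReal_mul, Complex.ofReal_ofNat] at h3
  linear_combination h1 + h2 + (Real.cos (Real.pi * ξ) : ℂ) * (Real.cosh (Real.pi * η) : ℂ) * h3

lemma sqrt_pi_mul_Gamma_div_Gamma {ξ : ℝ} (h : Real.cos (Real.pi * ξ) ≠ 0) :
    (Real.pi : ℂ) ^ ((1 : ℂ) / 2) * (2 : ℂ) ^ (-2 * (ξ : ℂ)) * Complex.Gamma (-(ξ : ℂ)) /
      Complex.Gamma (1 / 2 + (ξ : ℂ)) =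
    2 * Complex.Gamma (-2 * (ξ : ℂ)) * (Real.cos (Real.pi * ξ) : ℂ) := by
  have hpi : (Real.pi : ℂ) ≠ 0 := by exact_mod_cast Real.pi_ne_zero
  have hsin : Complex.sin (Real.pi * (1 / 2 - ξ)) = (Real.cos (Real.pi * ξ) : ℂ) := by
    rw [mul_sub, mul_one_div, Complex.sin_pi_div_two_sub, Complex.ofReal_cos, Complex.ofReal_mul]
  have hs : Complex.sin (Real.pi * (1 / 2 - ξ)) ≠ 0 := by
    rw [hsin]
    exact_mod_cast h
  have h1 := inv_Gamma_one_sub hs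
  have e1 : (1 : ℂ) - (1 / 2 - ξ) = 1 / 2 + ξ := by ring
  rw [hsin, e1] at h1
  have h2 := Complex.Gamma_mul_Gamma_add_half (-(ξ : ℂ))
  have e2 : -(ξ : ℂ) + 1 / 2 = 1 / 2 - ξ := by ring
  have e3 : 2 * -(ξ : ℂ) = -2 * ξ := by ring
  have hsqrt : ((Real.sqrt Real.pi : ℝ) : ℂ) = (Real.pi : ℂ) ^ ((1 : ℂ) / 2) := by
    rw [Real.sqrt_eq_rpow, Complex.ofReal_cpow Real.pi_pos.le]
    norm_num
  rw [e2, e3, hsqrt, Complex.cpow_sub _ _ two_ne_zero, Complex.cpow_one] at h2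
  have hpp : (Real.pi : ℂ) ^ ((1 : ℂ) / 2) * (Real.pi : ℂ) ^ ((1 : ℂ) / 2) = Real.pi := by
    rw [← Complex.cpow_add _ _ hpi]
    norm_num
  have h2ξ : (2 : ℂ) ^ (-2 * (ξ : ℂ)) ≠ 0 := by simp [Complex.cpow_eq_zero_iff]
  have h3 : (2 : ℂ) ^ (-2 * (ξ : ℂ)) *
      (Complex.Gamma (-(ξ : ℂ)) * Complex.Gamma (1 / 2 - ξ)) =
      2 * Complex.Gamma (-2 * (ξ : ℂ)) * (Real.pi : ℂ) ^ ((1 : ℂ) / 2) := by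
    rw [h2]
    field_simp
  apply mul_right_cancel₀ hpi
  rw [div_eq_mul_inv, mul_assoc, h1]
  linear_combination (Real.pi : ℂ) ^ ((1 : ℂ) / 2) * (Real.cos (Real.pi * ξ) : ℂ) * h3 +
    2 * Complex.Gamma (-2 * (ξ : ℂ)) * (Real.cos (Real.pi * ξ) : ℂ) * hpp

lemma integrable_and_integral_fz_mul_fz {ξ : ℝ} (h : ξ < 0) (η : ℝ) (k : ℤ) :
    Integrable (fun p : ℝ × ℝ => fz (ξ + η * Complex.I) (k + k) p.1 *
      fz (ξ - η * Complex.I) (-(k + k)) p.2 * ((|p.1 - p.2| ^ (-2 * ξ - 1) : ℝ) : ℂ)) ∧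
    ∫ p : ℝ × ℝ, fz (ξ + η * Complex.I) (k + k) p.1 *
      fz (ξ - η * Complex.I) (-(k + k)) p.2 * ((|p.1 - p.2| ^ (-2 * ξ - 1) : ℝ) : ℂ) =
    (-1) ^ k * ((Real.pi : ℂ) ^ (-(1/2) : ℂ) *
      ∫ p : ℝ × ℝ, fz (ξ + η * Complex.I) (k + k) p.1 * (((1 + p.2 ^ 2)⁻¹ : ℝ) •
        (((|p.1 + p.2| : ℝ) : ℂ) ^ (-2 * (η : ℂ) * Complex.I)))) := by
  have hH := (integrable_fz_mul_poisson h η (k + k)).const_mul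
    ((-1) ^ k * (Real.pi : ℂ) ^ (-(1/2) : ℂ))
  rw [← mul_assoc, ← integral_const_mul]
  refine integrable_and_integral_eq_of_rotation ?_ hH fun u => ?_
  · have m1 := measurable_fz (ξ + η * Complex.I) (k + k)
    have m2 := measurable_fz (ξ - η * Complex.I) (-(k + k))
    have m3 : Measurable fun p : ℝ × ℝ => ((|p.1 - p.2| ^ (-2 * ξ - 1) : ℝ) : ℂ) :=
      Complex.measurable_ofReal.comp (Measurable.pow_const (by fun_prop) _)
    exact (((m1.comp measurable_fst).mul (m2.comp measurable_snd)).mul m3).aestronglyMeasurable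
  · filter_upwards [Measure.ae_ne volume (-u)] with y hy
    rw [fz_rotation ξ η y u k fun h0 => hy (by linarith)]
    ring

/-- for `ζ = ξ+iη` with `-1/2 < ξ < 0` and `μ` even, with
`c(ξ) = π^{1/2} 2^{-2ξ} Γ(-ξ)/Γ(1/2+ξ)`, the double integral converges absolutely and
`(1/c(ξ)) ∬ f_{ζ,μ}(t) f_{conj ζ,-μ}(u) |t-u|^{-2ξ-1} dt du
  = 2^{2ξ} Re[(Γ(1/2+conj ζ+μ/2)/Γ(1/2-ζ+μ/2))(1 + i tan(πξ) tanh(πη))]`. -/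
theorem stmt_15 (ξ η : ℝ) (h1 : -(1/2) < ξ) (h2 : ξ < 0) (ζ : ℂ)
    (hζ : ζ = (ξ : ℂ) + (η : ℂ) * Complex.I) (μ : ℤ) (hμ : Even μ) :
    Integrable (fun p : ℝ × ℝ =>
        fz ζ μ p.1 * fz ((starRingEnd ℂ) ζ) (-μ) p.2 *
          ((|p.1 - p.2| ^ (-2 * ξ - 1) : ℝ) : ℂ)) ∧
    ((1 / ((Real.pi : ℂ) ^ ((1:ℂ)/2) * (2 : ℂ) ^ (-2 * (ξ : ℂ)) * Complex.Gamma (-(ξ : ℂ)) /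
          Complex.Gamma (1/2 + (ξ : ℂ)))) *
        ∫ p : ℝ × ℝ, fz ζ μ p.1 * fz ((starRingEnd ℂ) ζ) (-μ) p.2 *
          ((|p.1 - p.2| ^ (-2 * ξ - 1) : ℝ) : ℂ))
      = (((2 : ℝ) ^ (2 * ξ) *
          (Complex.Gamma (1/2 + (starRingEnd ℂ) ζ + (μ : ℂ)/2) /
              Complex.Gamma (1/2 - ζ + (μ : ℂ)/2) *
            (1 + Complex.I * (Real.tan (Real.pi * ξ) : ℂ) *
              (Real.tanh (Real.pi * η) : ℂ))).re : ℝ) : ℂ) := by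
  obtain ⟨k, rfl⟩ := hμ
  have hconj : (starRingEnd ℂ) ζ = ξ - η * Complex.I := by
    rw [hζ]
    simp [sub_eq_add_neg]
  rw [hconj, hζ]
  have hk : (((k + k : ℤ) : ℂ)) / 2 = (k : ℂ) := by push_cast; ring
  have hcos : Real.cos (Real.pi * ξ) ≠ 0 := by
    refine (Real.cos_pos_of_mem_Ioo ⟨?_, ?_⟩).ne' <;> nlinarith [Real.pi_pos]
  obtain ⟨hInt, heq⟩ := integrable_and_integral_fz_mul_fz h2 η k
  refine ⟨hInt, ?_⟩
  rw [heq, integral_fz_mul_poisson h2, sqrt_pi_mul_Gamma_div_Gamma hcos, hk]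
  have hsum := sum_inv_Gamma_mul_inv_Gamma η hcos k
  have hΓ : Complex.Gamma (-2 * (ξ : ℂ)) ≠ 0 := by
    have e : (-2 * (ξ : ℂ)) = ((-2 * ξ : ℝ) : ℂ) := by push_cast; ring
    refine Complex.Gamma_ne_zero_of_re_pos ?_
    rw [e, Complex.ofReal_re]
    linarith
  have hcosc : (Real.cos (Real.pi * ξ) : ℂ) ≠ 0 := by exact_mod_cast hcos
  have hcosh : (Real.cosh (Real.pi * η) : ℂ) ≠ 0 := by exact_mod_cast (Real.cosh_pos _).ne'
  rw [Complex.ofReal_mul, Complex.ofReal_cpow zero_le_two, Complex.ofReal_ofNat,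
    Complex.ofReal_mul, Complex.ofReal_ofNat, one_div_mul_eq_div,
    div_eq_iff (mul_ne_zero (mul_ne_zero two_ne_zero hΓ) hcosc)]
  have hcc := mul_inv_cancel₀ hcosh
  generalize (Real.cos (Real.pi * ξ) : ℂ) = c at *
  generalize (Real.cosh (Real.pi * η) : ℂ) = d at *
  linear_combination (2 : ℂ) ^ (2 * (ξ : ℂ)) * Complex.Gamma (-2 * (ξ : ℂ)) * d⁻¹ * hsum +
    2 * (2 : ℂ) ^ (2 * (ξ : ℂ)) * Complex.Gamma (-2 * (ξ : ℂ)) * c *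
    (((Complex.Gamma (1 / 2 + (ξ - η * Complex.I) + k) /
          Complex.Gamma (1 / 2 - (ξ + η * Complex.I) + k) *
        (1 + Complex.I * (Real.tan (Real.pi * ξ) : ℂ) *
          (Real.tanh (Real.pi * η) : ℂ))).re : ℝ) : ℂ) * hcc
end
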